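/- arXiv:math/9903200 — 3 statements merged into one kernel-verified Lean document; each statement's English description precedes it below -/
import Mathlib

section
/- Let n ≥ 2, let K be an origin-symmetric star body in ℝⁿ, let q ∈ (−1, 0), and let ξ ∈ S^{n−1}. Then ∫_ℝ |z|^{−q−1} A_ξ(z) dz = (1/(n−q−1)) ∫_{S^{n−1}} |⟨θ, ξ⟩|^{−q−1} ρ_K(θ)^{n−q−1} dθ, where the integral over S^{n−1} is with respect to (n−1)-dimensional Hausdorff measure. -/
open MeasureTheory Set
open scoped RealInnerProductSpace ENNReal

lemma exists_coord (d : ℕ) (ξ : EuclideanSpace ℝ (Fin (d+1))) (hξ : ‖ξ‖ = 1) :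
    ∃ L : (EuclideanSpace ℝ (Fin d) × ℝ) ≃L[ℝ] EuclideanSpace ℝ (Fin (d+1)),
      MeasurePreserving L ∧ L (0, 1) = ξ ∧ (∀ p, ‖L p‖ ^ 2 = ‖p.1‖ ^ 2 + p.2 ^ 2) ∧
      ∀ p, ⟪L p, ξ⟫ = p.2 := by
  classical
  let v : Fin d ⊕ Unit → EuclideanSpace ℝ (Fin (d+1)) := fun _ => ξ
  have hv : Orthonormal ℝ (({Sum.inr ()} : Set (Fin d ⊕ Unit)).domRestrict v) := by
    constructor
    · intro i; exact hξ
    · intro i j hij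
      exact absurd (Subsingleton.elim i j) hij
  obtain ⟨b, hb⟩ := hv.exists_orthonormalBasis_extension_of_card_eq (by simp)
  have hbξ : b (Sum.inr ()) = ξ := hb _ rfl
  let c : OrthonormalBasis (Fin d ⊕ Unit) ℝ (WithLp 2 (EuclideanSpace ℝ (Fin d) × ℝ)) :=
    (EuclideanSpace.basisFun (Fin d) ℝ).prod (OrthonormalBasis.singleton Unit ℝ)
  let ψ := c.equiv b (Equiv.refl _)
  have hc : c (Sum.inr ()) = WithLp.toLp 2 (0, 1) := by simp [c]
  have h1 : ψ (WithLp.toLp 2 (0, 1)) = ξ := by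
    rw [← hc, ← hbξ]; simp [ψ]
  refine ⟨(WithLp.prodContinuousLinearEquiv 2 ℝ _ _).symm.trans ψ.toContinuousLinearEquiv,
    ?_, ?_, ?_, ?_⟩
  · exact (ψ.measurePreserving).comp (WithLp.volume_preserving_toLp _ _)
  · exact h1
  · intro p
    change ‖ψ (WithLp.toLp 2 p)‖ ^ 2 = _
    rw [ψ.norm_map, WithLp.prod_norm_sq_eq_of_L2]
    simp
  · intro p
    change ⟪ψ (WithLp.toLp 2 p), ξ⟫ = _
    rw [← h1, ψ.inner_map_map]
    simp [WithLp.prod_inner_apply]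

lemma hausdorff_cmp {X Y Z : Type*} [MetricSpace Y] [MeasurableSpace Y] [BorelSpace Y]
    [MetricSpace Z] [MeasurableSpace Z] [BorelSpace Z] (f : X → Y) (g : X → Z) (s : Set X)
    (C : NNReal) (h : ∀ x ∈ s, ∀ y ∈ s, dist (f x) (f y) ≤ C * dist (g x) (g y))
    {d : ℝ} (hd : 0 ≤ d) :
    μH[d] (f '' s) ≤ (C : ℝ≥0∞) ^ d * μH[d] (g '' s) := by
  rcases s.eq_empty_or_nonempty with rfl | ⟨x0, hx0⟩
  · simp
  have : Nonempty X := ⟨x0⟩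
  have key : ∀ z ∈ g '' s, Function.invFunOn g s z ∈ s ∧ g (Function.invFunOn g s z) = z :=
    fun z hz => ⟨Function.invFunOn_mem hz, Function.invFunOn_eq hz⟩
  have hl : LipschitzOnWith C (f ∘ Function.invFunOn g s) (g '' s) := by
    apply LipschitzOnWith.of_dist_le_mul
    intro a ha b hb
    have := h _ (key a ha).1 _ (key b hb).1
    rwa [(key a ha).2, (key b hb).2] at this
  have := hl.hausdorffMeasure_image_le hd
  convert this using 2
  rw [image_image]
  apply image_congr
  intro x hx
  have hk := key (g x) ⟨x, hx, rfl⟩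
  have := h x hx _ hk.1
  rw [hk.2, dist_self, mul_zero] at this
  exact dist_le_zero.1 this

lemma hausdorff_eq (d : ℕ) : ∃ c : ℝ≥0∞, c ≠ 0 ∧ c ≠ ⊤ ∧
    (μH[(d : ℝ)] : Measure (EuclideanSpace ℝ (Fin d))) = c • volume := by
  have h : (μH[(d : ℝ)] : Measure (EuclideanSpace ℝ (Fin d))).IsAddHaarMeasure := by
    have := isAddHaarMeasure_hausdorffMeasure (E := EuclideanSpace ℝ (Fin d))
    simpa using this
  refine ⟨(Measure.addHaarScalarFactor (μH[(d : ℝ)] : Measure (EuclideanSpace ℝ (Fin d))) volume : NNReal), ?_, by simp, ?_⟩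
  · have := Measure.addHaarScalarFactor_pos_of_isAddHaarMeasure (μH[(d : ℝ)] : Measure (EuclideanSpace ℝ (Fin d))) volume
    simpa using this.ne'
  · exact Measure.isAddLeftInvariant_eq_smul _ _

lemma volume_cmp {X : Type*} (n : ℕ) (f g : X → EuclideanSpace ℝ (Fin n)) (s : Set X)
    (C : NNReal) (h : ∀ x ∈ s, ∀ y ∈ s, dist (f x) (f y) ≤ C * dist (g x) (g y)) :
    volume (f '' s) ≤ (C : ℝ≥0∞) ^ n * volume (g '' s) := by
  obtain ⟨c, h0, ht, hc⟩ := hausdorff_eq n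
  have := hausdorff_cmp f g s C h (d := n) (by positivity)
  rw [hc] at this
  simp only [Measure.smul_apply, smul_eq_mul, ENNReal.rpow_natCast] at this
  rw [mul_left_comm] at this
  exact (ENNReal.mul_le_mul_iff_right h0 ht).1 this

lemma polar (d : ℕ) (f : EuclideanSpace ℝ (Fin (d+1)) → ℝ≥0∞) (hf : Measurable f) :
    ∫⁻ x, f x = ∫⁻ θ : Metric.sphere (0 : EuclideanSpace ℝ (Fin (d+1))) 1,
      (∫⁻ r in Ioi (0:ℝ), ENNReal.ofReal (r ^ d) * f (r • θ.1))
        ∂(volume : Measure (EuclideanSpace ℝ (Fin (d+1)))).toSphere := by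
  have hmp := (volume : Measure (EuclideanSpace ℝ (Fin (d+1)))).measurePreserving_homeomorphUnitSphereProd
  rw [← restrict_compl_singleton (μ := (volume : Measure (EuclideanSpace ℝ (Fin (d+1))))) 0,
    ← lintegral_subtype_comap (measurableSet_singleton _).compl]
  have h2 := hmp.lintegral_comp (f := fun p => f (p.2.1 • p.1.1)) (by fun_prop)
  rw [lintegral_prod _ (by fun_prop)] at h2
  have h3 : Module.finrank ℝ (EuclideanSpace ℝ (Fin (d+1))) - 1 = d := by simp
  rw [h3] at h2
  convert h2 using 1
  · apply lintegral_congr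
    intro x
    congr 1
    have : (x:EuclideanSpace ℝ (Fin (d+1))) ≠ 0 := x.2
    simp [smul_smul, this]
  · simp only [restrict_compl_singleton]
    apply lintegral_congr
    intro θ
    rw [Measure.volumeIoiPow, lintegral_withDensity_eq_lintegral_mul _ (by fun_prop) (by fun_prop)]
    rw [← lintegral_subtype_comap measurableSet_Ioi]
    rfl

lemma measure_le_of_local {X : Type*} [TopologicalSpace X] [SecondCountableTopology X]
    [MeasurableSpace X] [BorelSpace X] (μ ν : Measure X)
    (h : ∀ x : X, ∃ U : Set X, IsOpen U ∧ x ∈ U ∧ ∀ A, MeasurableSet A → A ⊆ U → μ A ≤ ν A) :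
    μ ≤ ν := by
  rcases isEmpty_or_nonempty X with hX | hX
  · rw [Measure.eq_zero_of_isEmpty μ]; exact Measure.zero_le _
  choose U hU hxU hA using h
  obtain ⟨s, hs, hsU⟩ := TopologicalSpace.countable_cover_nhds (f := U)
    (fun x => (hU x).mem_nhds (hxU x))
  have hne : s.Nonempty := by
    by_contra hne
    rw [not_nonempty_iff_eq_empty] at hne
    subst hne
    simp at hsU
    exact empty_ne_univ hsU
  obtain ⟨e, rfl⟩ := hs.exists_eq_range hne
  let V : ℕ → Set X := fun n => U (e n)
  have hV : ⋃ n, V n = univ := by rw [← hsU]; simp [V]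
  refine Measure.le_iff.2 fun A hAm => ?_
  have hm : ∀ n, MeasurableSet (A ∩ disjointed V n) := fun n =>
    hAm.inter (MeasurableSet.disjointed (fun n => (hU _).measurableSet) n)
  have hd : Pairwise (Function.onFun Disjoint fun n => A ∩ disjointed V n) := fun i j hij =>
    ((disjoint_disjointed V) hij).mono inter_subset_right inter_subset_right
  have hAe : A = ⋃ n, A ∩ disjointed V n := by
    rw [← inter_iUnion, iUnion_disjointed, hV, inter_univ]
  rw [hAe, measure_iUnion hd hm, measure_iUnion hd hm]
  exact ENNReal.tsum_le_tsum fun n => hA (e n) _ (hm n)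
    (inter_subset_right.trans (disjointed_subset V n))

lemma shell (d : ℕ) (A : Set (Metric.sphere (0 : EuclideanSpace ℝ (Fin (d+1))) 1))
    (hA : MeasurableSet A) (a b : ℝ) (ha : 0 ≤ a) :
    MeasurableSet {x : EuclideanSpace ℝ (Fin (d+1)) |
      ‖x‖ ∈ Ioo a b ∧ ‖x‖⁻¹ • x ∈ Subtype.val '' A} ∧
    volume {x : EuclideanSpace ℝ (Fin (d+1)) | ‖x‖ ∈ Ioo a b ∧ ‖x‖⁻¹ • x ∈ Subtype.val '' A}
      = (volume : Measure (EuclideanSpace ℝ (Fin (d+1)))).toSphere A *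
        ∫⁻ r in Ioo a b, ENNReal.ofReal (r ^ d) := by
  have hm : MeasurableSet {x : EuclideanSpace ℝ (Fin (d+1)) |
      ‖x‖ ∈ Ioo a b ∧ ‖x‖⁻¹ • x ∈ Subtype.val '' A} := by
    have h1 : MeasurableSet (Subtype.val '' A) :=
      (MeasurableEmbedding.subtype_coe Metric.isClosed_sphere.measurableSet).measurableSet_image.2 hA
    exact (measurable_norm measurableSet_Ioo).inter
      ((show Measurable fun x : EuclideanSpace ℝ (Fin (d+1)) => ‖x‖⁻¹ • x by fun_prop) h1)
  refine ⟨hm, ?_⟩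
  rw [← lintegral_indicator_one hm, polar d _ (measurable_one.indicator hm)]
  rw [mul_comm, ← lintegral_indicator_const hA]
  apply lintegral_congr
  intro θ
  have hθ : ‖(θ : EuclideanSpace ℝ (Fin (d+1)))‖ = 1 := by simp
  have key : ∀ r : ℝ, 0 < r → ((r • (θ : EuclideanSpace ℝ (Fin (d+1)))) ∈
      {x : EuclideanSpace ℝ (Fin (d+1)) | ‖x‖ ∈ Ioo a b ∧ ‖x‖⁻¹ • x ∈ Subtype.val '' A} ↔
      r ∈ Ioo a b ∧ θ ∈ A) := by
    intro r hr
    simp only [mem_ofPred_eq, norm_smul, hθ, Real.norm_eq_abs, abs_of_pos hr, mul_one, smul_smul,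
      inv_mul_cancel₀ hr.ne', one_smul, Subtype.val_injective.mem_set_image]
  by_cases hθA : θ ∈ A
  · rw [indicator_of_mem hθA]
    have : Ioo a b = Ioi 0 ∩ Ioo a b := by
      ext x; simp; intro h _; linarith
    have hI : ∫⁻ r in Ioo a b, ENNReal.ofReal (r ^ d) =
        ∫⁻ r in Ioi 0, (Ioo a b).indicator (fun r => ENNReal.ofReal (r ^ d)) r := by
      rw [lintegral_indicator measurableSet_Ioo, Measure.restrict_restrict measurableSet_Ioo,
        inter_comm, ← this]
    rw [hI]
    apply setLIntegral_congr_fun measurableSet_Ioi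
    intro r hr
    have := key r hr
    by_cases h : r ∈ Ioo a b
    · simp only [indicator_of_mem (this.2 ⟨h, hθA⟩), indicator_of_mem h, Pi.one_apply, mul_one]
    · have h' := fun hh => h (this.1 hh).1
      simp only [indicator_of_notMem h, indicator_of_notMem h', mul_zero]
  · rw [indicator_of_notMem hθA, lintegral_eq_zero_iff' (by
      apply Measurable.aemeasurable
      have := (measurable_one (α := ℝ≥0∞)).indicator hm
      exact Measurable.mul (by fun_prop) (this.comp (by fun_prop)))]
    filter_upwards [ae_restrict_mem measurableSet_Ioi] with r hr
    have h' := fun hh => hθA ((key r hr).1 hh).2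
    simp only [indicator_of_notMem h', mul_zero, Pi.zero_apply]

lemma chart_deriv (d : ℕ) (L : (EuclideanSpace ℝ (Fin d) × ℝ) ≃L[ℝ] EuclideanSpace ℝ (Fin (d+1))) :
    HasStrictFDerivAt (fun p : EuclideanSpace ℝ (Fin d) × ℝ =>
      (p.2 * (√(‖p.1‖ ^ 2 + 1))⁻¹) • L (p.1, 1))
      (L : (EuclideanSpace ℝ (Fin d) × ℝ) →L[ℝ] EuclideanSpace ℝ (Fin (d+1))) (0, 1) := by
  have h1 : HasStrictDerivAt (fun u : ℝ => (√(u + 1))⁻¹) _ (‖(0 : EuclideanSpace ℝ (Fin d))‖ ^ 2) :=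
    ContDiffAt.hasStrictDerivAt (n := 1) (by
      have h0 : ContDiffAt ℝ 1 (fun u : ℝ => √(u + 1)) (‖(0 : EuclideanSpace ℝ (Fin d))‖ ^ 2) :=
        (contDiffAt_id.add contDiffAt_const).sqrt (by simp)
      exact h0.inv (by simp)) one_ne_zero
  have h2 : HasStrictFDerivAt (fun y : EuclideanSpace ℝ (Fin d) => ‖y‖ ^ 2) _ 0 :=
    hasStrictFDerivAt_norm_sq 0
  have h3 := HasStrictDerivAt.comp_hasStrictFDerivAt (f := fun y : EuclideanSpace ℝ (Fin d) => ‖y‖ ^ 2) 0 h1 h2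
  have h4 := h3.comp (0, (1 : ℝ)) (hasStrictFDerivAt_fst (𝕜 := ℝ) (E := EuclideanSpace ℝ (Fin d)) (F := ℝ) (p := (0, 1)))
  have h5 := (hasStrictFDerivAt_snd (𝕜 := ℝ) (E := EuclideanSpace ℝ (Fin d)) (F := ℝ) (p := (0, 1))).mul h4
  have h6 : HasStrictFDerivAt (fun p : EuclideanSpace ℝ (Fin d) × ℝ => L (p.1, 1)) _ (0, 1) :=
    L.hasStrictFDerivAt.comp (0, (1 : ℝ)) ((hasStrictFDerivAt_fst (𝕜 := ℝ) (E := EuclideanSpace ℝ (Fin d)) (F := ℝ) (p := (0, 1))).prodMk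
      (hasStrictFDerivAt_const (1 : ℝ) _))
  have h7 := h5.smul h6
  refine h7.congr_fderiv ?_
  ext p
  · simp
  · have h0 : L (0, 0) = 0 := map_zero L
    simp [h0]

lemma local_cmp (d : ℕ) (c : ℝ≥0∞)
    (hc : (μH[(d : ℝ)] : Measure (EuclideanSpace ℝ (Fin d))) = c • volume)
    (θ : Metric.sphere (0 : EuclideanSpace ℝ (Fin (d+1))) 1) (k : NNReal) (hk : 1 < k) :
    ∃ U : Set (Metric.sphere (0 : EuclideanSpace ℝ (Fin (d+1))) 1), IsOpen U ∧ θ ∈ U ∧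
      ∀ A, MeasurableSet A → A ⊆ U →
        μH[(d : ℝ)] (Subtype.val '' A) ≤ (k : ℝ≥0∞) ^ (3 * d + 1) *
          (c * (volume : Measure (EuclideanSpace ℝ (Fin (d+1)))).toSphere A) ∧
        c * (volume : Measure (EuclideanSpace ℝ (Fin (d+1)))).toSphere A
          ≤ (k : ℝ≥0∞) ^ (3 * d + 1) * μH[(d : ℝ)] (Subtype.val '' A) := by
  have hθ : ‖(θ : EuclideanSpace ℝ (Fin (d+1)))‖ = 1 := by simp
  obtain ⟨L, hLm, hL1, hLn, hLi⟩ := exists_coord d θ hθ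
  set Ψ : EuclideanSpace ℝ (Fin d) × ℝ → EuclideanSpace ℝ (Fin (d+1)) := fun p =>
      (p.2 * (√(‖p.1‖ ^ 2 + 1))⁻¹) • L (p.1, 1) with hΨ
  have hk' : (1 : ℝ) < k := by exact_mod_cast hk
  have hk0 : (0 : ℝ) < k := by linarith
  set ε : ℝ := 1 - (k : ℝ)⁻¹ with hε
  have hinv : (k : ℝ)⁻¹ < 1 := inv_lt_one_of_one_lt₀ hk'
  have hinv0 : 0 < (k : ℝ)⁻¹ := by positivity
  have hε0 : 0 < ε := by linarith
  have hεk : 1 + ε ≤ k := by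
    have : (k : ℝ) * (k : ℝ)⁻¹ = 1 := mul_inv_cancel₀ hk0.ne'
    nlinarith
  obtain ⟨s, hs, happ⟩ := (chart_deriv d L).approximates_deriv_on_nhds
    (c := ⟨ε, hε0.le⟩) (Or.inr (by exact_mod_cast hε0))
  obtain ⟨r', hr', hrs⟩ := Metric.mem_nhds_iff.1 hs
  set r := min r' ε with hr
  have hr0 : 0 < r := lt_min hr' hε0
  have hrε : r ≤ ε := min_le_right _ _
  have hsub : ∀ p : EuclideanSpace ℝ (Fin d) × ℝ, ‖p.1‖ < r → p.2 ∈ Ioo (1 - r) (1 + r) → p ∈ s := by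
    intro p h1 h2
    apply hrs
    rw [Metric.mem_ball, Prod.dist_eq, max_lt_iff]
    refine ⟨by simpa using h1.trans_le (min_le_left _ _), ?_⟩
    rw [Real.dist_eq, abs_lt]
    have := min_le_left r' ε
    constructor <;> linarith [h2.1, h2.2]
  have hnorm : ∀ p : EuclideanSpace ℝ (Fin d) × ℝ, ‖p‖ ≤ ‖L p‖ := by
    intro p
    rw [Prod.norm_def]
    apply max_le
    · apply abs_le_of_sq_le_sq' _ (norm_nonneg _) |>.2
      rw [hLn]; nlinarith [sq_nonneg p.2]
    · rw [Real.norm_eq_abs]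
      apply abs_le_of_sq_le_sq _ (norm_nonneg _)
      rw [hLn]; nlinarith [sq_nonneg ‖p.1‖]
  have hd1 : ∀ p ∈ s, ∀ p' ∈ s, dist (Ψ p) (Ψ p') ≤ k * dist (L p) (L p') := by
    intro p hp p' hp'
    have h1 : ‖Ψ p - Ψ p' - L (p - p')‖ ≤ ε * ‖p - p'‖ := happ p hp p' hp'
    have h2 := hnorm (p - p')
    rw [dist_eq_norm, dist_eq_norm, ← map_sub]
    have h3 : ‖Ψ p - Ψ p'‖ ≤ ‖Ψ p - Ψ p' - L (p - p')‖ + ‖L (p - p')‖ := norm_le_norm_sub_add _ _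
    nlinarith [norm_nonneg (L (p - p'))]
  have hd2 : ∀ p ∈ s, ∀ p' ∈ s, dist (L p) (L p') ≤ k * dist (Ψ p) (Ψ p') := by
    intro p hp p' hp'
    have h1 : ‖Ψ p - Ψ p' - L (p - p')‖ ≤ ε * ‖p - p'‖ := happ p hp p' hp'
    have h2 := hnorm (p - p')
    rw [dist_eq_norm, dist_eq_norm, ← map_sub]
    have h3 : ‖L (p - p')‖ ≤ ‖Ψ p - Ψ p' - L (p - p')‖ + ‖Ψ p - Ψ p'‖ := by
      rw [norm_sub_rev]; exact norm_le_norm_sub_add _ _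
    have h4 : (k : ℝ)⁻¹ * ‖L (p - p')‖ ≤ ‖Ψ p - Ψ p'‖ := by
      nlinarith
    rwa [inv_mul_le_iff₀ hk0] at h4
  have hLd : ∀ y y' : EuclideanSpace ℝ (Fin d), dist (L (y, 1)) (L (y', 1)) = dist y y' := by
    intro y y'
    rw [dist_eq_norm, dist_eq_norm, ← map_sub, ← sq_eq_sq₀ (norm_nonneg _) (norm_nonneg _), hLn]
    simp
  have hΨ1 : ∀ y : EuclideanSpace ℝ (Fin d), ‖Ψ (y, 1)‖ = 1 := by
    intro y
    have h1 : ‖L (y, 1)‖ = √(‖y‖ ^ 2 + 1) := by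
      rw [← Real.sqrt_sq (norm_nonneg (L (y, 1))), hLn]; simp
    have : 0 < √(‖y‖ ^ 2 + 1) := by positivity
    simp only [hΨ, norm_smul, h1, one_mul, norm_inv, Real.norm_eq_abs, abs_of_pos this]
    exact inv_mul_cancel₀ this.ne'
  have hΨt : ∀ (y : EuclideanSpace ℝ (Fin d)) (t : ℝ), Ψ (y, t) = t • Ψ (y, 1) := by
    intro y t; simp [hΨ, smul_smul]
  have hΨc : Continuous fun y : EuclideanSpace ℝ (Fin d) => Ψ (y, 1) := by
    simp only [hΨ]
    have : ∀ y : EuclideanSpace ℝ (Fin d), √(‖y‖ ^ 2 + 1) ≠ 0 := fun y => by positivity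
    fun_prop (disch := exact this _)
  refine ⟨{x | 0 < (L.symm x).2 ∧ ‖(L.symm x).1‖ < r * (L.symm x).2}, ?_, ?_, ?_⟩
  · have o1 : IsOpen {x : Metric.sphere (0 : EuclideanSpace ℝ (Fin (d+1))) 1 | 0 < (L.symm x).2} :=
      isOpen_lt (by fun_prop) (by fun_prop)
    have o2 : IsOpen {x : Metric.sphere (0 : EuclideanSpace ℝ (Fin (d+1))) 1 |
        ‖(L.symm x).1‖ < r * (L.symm x).2} :=
      isOpen_lt (by fun_prop) (by fun_prop)
    exact o1.inter o2
  · have : L.symm θ = (0, 1) := by rw [← hL1]; simp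
    simp [this, hr0]
  intro A hA hAU
  have hAm : MeasurableSet (Subtype.val '' A) :=
      (MeasurableEmbedding.subtype_coe Metric.isClosed_sphere.measurableSet).measurableSet_image.2 hA
  set B : Set (EuclideanSpace ℝ (Fin d)) := {y | ‖y‖ < r ∧ Ψ (y, 1) ∈ Subtype.val '' A} with hB
  have hBm : MeasurableSet B := by
    have o1 : MeasurableSet {y : EuclideanSpace ℝ (Fin d) | ‖y‖ < r} :=
      measurableSet_lt (by fun_prop) (by fun_prop)
    exact o1.inter (hΨc.measurable hAm)
  have hAB : Subtype.val '' A = (fun y => Ψ (y, 1)) '' B := by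
    apply Subset.antisymm
    · rintro _ ⟨x, hx, rfl⟩
      have hxU := hAU hx
      have hxn : ‖(x : EuclideanSpace ℝ (Fin (d+1)))‖ = 1 := by simp
      obtain ⟨ht, hy⟩ := hxU
      set y := (L.symm x).1
      set t := (L.symm x).2
      have hxL : L (y, t) = x := by simp [y, t]
      have e1 : L (t⁻¹ • y, 1) = t⁻¹ • (x : EuclideanSpace ℝ (Fin (d+1))) := by
        rw [← hxL, ← map_smul]; simp [ht.ne']
      have e2 : ‖t⁻¹ • y‖ ^ 2 + 1 = (t⁻¹) ^ 2 := by
        have := hLn (t⁻¹ • y, 1)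
        rw [e1, norm_smul, hxn] at this
        simp at this ⊢
        linarith
      have e3 : Ψ (t⁻¹ • y, 1) = x := by
        simp only [hΨ]
        rw [e1, e2, Real.sqrt_sq (by positivity), smul_smul]
        simp [ht.ne']
      refine ⟨t⁻¹ • y, ⟨?_, ?_⟩, e3⟩
      · rw [norm_smul, norm_inv, Real.norm_eq_abs, abs_of_pos ht, inv_mul_lt_iff₀ ht, mul_comm]
        exact hy
      · rw [e3]; exact ⟨x, hx, rfl⟩
    · rintro _ ⟨y, hy, rfl⟩
      exact hy.2
  set J := Ioo (1 - r) (1 + r) with hJ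
  have hBJ : ∀ p ∈ B ×ˢ J, p ∈ s := fun p hp => hsub p hp.1.1 hp.2
  have h1J : (1 : ℝ) ∈ J := ⟨by linarith, by linarith⟩
  obtain ⟨hTm, hT⟩ := shell d A hA (1 - r) (1 + r) (by linarith)
  have hTeq : {x : EuclideanSpace ℝ (Fin (d+1)) | ‖x‖ ∈ Ioo (1 - r) (1 + r) ∧
      ‖x‖⁻¹ • x ∈ Subtype.val '' A} = Ψ '' (B ×ˢ J) := by
    ext x
    constructor
    · rintro ⟨h1, h2⟩
      rw [hAB] at h2
      obtain ⟨y, hy, hyx⟩ := h2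
      refine ⟨(y, ‖x‖), ⟨hy, h1⟩, ?_⟩
      have : 0 < ‖x‖ := by linarith [h1.1]
      simp only at hyx
      rw [hΨt, hyx, smul_smul, mul_inv_cancel₀ this.ne', one_smul]
    · rintro ⟨⟨y, t⟩, ⟨hy, ht⟩, rfl⟩
      simp only at hy ht
      have ht0 : 0 < t := by linarith [ht.1]
      have : ‖Ψ (y, t)‖ = t := by
        rw [hΨt, norm_smul, hΨ1, Real.norm_eq_abs, abs_of_pos ht0, mul_one]
      refine ⟨by rw [this]; exact ht, ?_⟩
      rw [this, hΨt, smul_smul, inv_mul_cancel₀ ht0.ne', one_smul]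
      exact hy.2
  rw [hTeq] at hT
  set w := ENNReal.ofReal (2 * r) with hw
  have hw0 : w ≠ 0 := by simpa [hw] using hr0
  have hwt : w ≠ ⊤ := ENNReal.ofReal_ne_top
  set S := (volume : Measure (EuclideanSpace ℝ (Fin (d+1)))).toSphere A
  set M := ∫⁻ r in J, ENNReal.ofReal (r ^ d) with hM
  set V := volume B
  set H := μH[(d : ℝ)] (Subtype.val '' A)
  have hJv : volume J = w := by rw [hJ, Real.volume_Ioo, hw]; congr 1; ring
  have hLV : volume (L '' (B ×ˢ J)) = V * w := by
    have : MeasurableEmbedding L := L.toHomeomorph.measurableEmbedding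
    rw [← hLm.measure_preimage_emb this, preimage_image_eq _ L.injective, Measure.volume_eq_prod,
      Measure.prod_prod, hJv]
  have hkE : ((k : NNReal) : ℝ≥0∞) = ENNReal.ofReal k := by simp
  have f1 : H ≤ k ^ d * (c * V) := by
    have := hausdorff_cmp (fun y => Ψ (y, 1)) (fun y => y) B k (by
      intro y hy y' hy'
      rw [← hLd y y']
      exact hd1 _ (hBJ (y, 1) ⟨hy, h1J⟩) _ (hBJ (y', 1) ⟨hy', h1J⟩)) (d := d) (by positivity)
    rw [← hAB, hc] at this
    simpa using this
  have f2 : c * V ≤ k ^ d * H := by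
    have := hausdorff_cmp (fun y => y) (fun y => Ψ (y, 1)) B k (by
      intro y hy y' hy'
      rw [← hLd y y']
      exact hd2 _ (hBJ (y, 1) ⟨hy, h1J⟩) _ (hBJ (y', 1) ⟨hy', h1J⟩)) (d := d) (by positivity)
    rw [← hAB, hc] at this
    simpa using this
  have f3 : S * M ≤ k ^ (d + 1) * (V * w) := by
    rw [← hT, ← hLV]
    exact volume_cmp _ _ _ _ k fun p hp p' hp' => hd1 p (hBJ p hp) p' (hBJ p' hp')
  have f4 : V * w ≤ k ^ (d + 1) * (S * M) := by
    rw [← hT, ← hLV]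
    exact volume_cmp _ _ _ _ k fun p hp p' hp' => hd2 p (hBJ p hp) p' (hBJ p' hp')
  have f5 : M ≤ k ^ d * w := by
    rw [hM, ← hJv, ← setLIntegral_const]
    apply setLIntegral_mono' measurableSet_Ioo
    intro t ht
    rw [hkE, ← ENNReal.ofReal_pow hk0.le]
    apply ENNReal.ofReal_le_ofReal
    exact pow_le_pow_left₀ (by linarith [ht.1]) (by linarith [ht.2]) _
  have f6 : w ≤ k ^ d * M := by
    rw [hM, ← lintegral_const_mul _ (by fun_prop), ← hJv, ← setLIntegral_one]
    apply setLIntegral_mono' measurableSet_Ioo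
    intro t ht
    have ht0 : 0 < t := by linarith [ht.1]
    rw [hkE, ← ENNReal.ofReal_pow hk0.le, ← ENNReal.ofReal_mul (by positivity), ← mul_pow,
      ← ENNReal.ofReal_one]
    apply ENNReal.ofReal_le_ofReal
    apply one_le_pow₀
    have : (k : ℝ)⁻¹ ≤ t := by linarith [ht.1]
    rwa [inv_le_iff_one_le_mul₀' hk0] at this
  constructor
  · have g : V ≤ k ^ (d + 1) * (S * k ^ d) := by
      rw [← ENNReal.mul_le_mul_iff_left hw0 hwt]
      calc V * w ≤ k ^ (d + 1) * (S * M) := f4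
        _ ≤ k ^ (d + 1) * (S * (k ^ d * w)) := by gcongr
        _ = _ := by ring
    calc H ≤ k ^ d * (c * V) := f1
      _ ≤ k ^ d * (c * (k ^ (d + 1) * (S * k ^ d))) := by gcongr
      _ = _ := by ring
  · have g : S ≤ k ^ d * (k ^ (d + 1) * V) := by
      rw [← ENNReal.mul_le_mul_iff_left hw0 hwt]
      calc S * w ≤ S * (k ^ d * M) := by gcongr
        _ = k ^ d * (S * M) := by ring
        _ ≤ k ^ d * (k ^ (d + 1) * (V * w)) := by gcongr
        _ = _ := by ring
    calc c * S ≤ c * (k ^ d * (k ^ (d + 1) * V)) := by gcongr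
      _ = k ^ (2 * d + 1) * (c * V) := by ring
      _ ≤ k ^ (2 * d + 1) * (k ^ d * H) := by gcongr
      _ = _ := by ring

lemma le_of_forall_k {a b : ℝ≥0∞} (m : ℕ) (h : ∀ k : NNReal, 1 < k → a ≤ (k : ℝ≥0∞) ^ m * b) :
    a ≤ b := by
  rcases eq_or_ne b ⊤ with rfl | hb
  · exact le_top
  have ht : Filter.Tendsto (fun k : NNReal => ((k ^ m : NNReal) : ℝ≥0∞) * b) (nhdsWithin 1 (Ioi 1))
      (nhds (((1 ^ m : NNReal) : ℝ≥0∞) * b)) := by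
    apply ENNReal.Tendsto.mul_const _ (Or.inr hb)
    apply ENNReal.tendsto_coe.2
    exact ((continuous_pow m).tendsto 1).mono_left nhdsWithin_le_nhds
  have := ge_of_tendsto ht (Filter.eventually_of_mem self_mem_nhdsWithin fun k hk => by
    have := h k hk
    simpa using this)
  simpa using this

lemma sphere_measure (d : ℕ) (c : ℝ≥0∞)
    (hc : (μH[(d : ℝ)] : Measure (EuclideanSpace ℝ (Fin d))) = c • volume) :
    (μH[(d : ℝ)] : Measure (EuclideanSpace ℝ (Fin (d+1)))).comap
      (Subtype.val : Metric.sphere (0 : EuclideanSpace ℝ (Fin (d+1))) 1 → _) =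
    c • (volume : Measure (EuclideanSpace ℝ (Fin (d+1)))).toSphere := by
  have hap : ∀ A : Set (Metric.sphere (0 : EuclideanSpace ℝ (Fin (d+1))) 1),
      (μH[(d : ℝ)] : Measure (EuclideanSpace ℝ (Fin (d+1)))).comap Subtype.val A =
      μH[(d : ℝ)] (Subtype.val '' A) := fun A =>
    comap_subtype_coe_apply Metric.isClosed_sphere.measurableSet _ _
  apply le_antisymm
  · refine Measure.le_iff.2 fun A hA => le_of_forall_k (3 * d + 1) fun k hk => ?_
    have : (μH[(d : ℝ)] : Measure (EuclideanSpace ℝ (Fin (d+1)))).comap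
      (Subtype.val : Metric.sphere (0 : EuclideanSpace ℝ (Fin (d+1))) 1 → _) ≤
      ((k : ℝ≥0∞) ^ (3 * d + 1)) • c • (volume : Measure (EuclideanSpace ℝ (Fin (d+1)))).toSphere := by
      apply measure_le_of_local
      intro x
      obtain ⟨U, h1, h2, h3⟩ := local_cmp d c hc x k hk
      refine ⟨U, h1, h2, fun A hA hAU => ?_⟩
      rw [hap]
      exact (h3 A hA hAU).1
    exact this A
  · refine Measure.le_iff.2 fun A hA => le_of_forall_k (3 * d + 1) fun k hk => ?_
    have : c • (volume : Measure (EuclideanSpace ℝ (Fin (d+1)))).toSphere ≤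
      ((k : ℝ≥0∞) ^ (3 * d + 1)) • (μH[(d : ℝ)] : Measure (EuclideanSpace ℝ (Fin (d+1)))).comap
      (Subtype.val : Metric.sphere (0 : EuclideanSpace ℝ (Fin (d+1))) 1 → _) := by
      apply measure_le_of_local
      intro x
      obtain ⟨U, h1, h2, h3⟩ := local_cmp d c hc x k hk
      refine ⟨U, h1, h2, fun A hA hAU => ?_⟩
      rw [Measure.smul_apply _ (Measure.comap _ _), hap]
      exact (h3 A hA hAU).2
    exact this A

lemma slice_int (d : ℕ) (c : ℝ≥0∞)
    (hc : (μH[(d : ℝ)] : Measure (EuclideanSpace ℝ (Fin d))) = c • volume) (hct : c ≠ ⊤)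
    (K : Set (EuclideanSpace ℝ (Fin (d+1)))) (hK : IsCompact K) (p : ℝ)
    (ξ : EuclideanSpace ℝ (Fin (d+1))) (hξ : ‖ξ‖ = 1) :
    ∫ z : ℝ, |z| ^ p *
        (μH[(d : ℝ)] (K ∩ {x : EuclideanSpace ℝ (Fin (d+1)) | ⟪x, ξ⟫ = z})).toReal
      = (c * ∫⁻ x, K.indicator (fun x => ENNReal.ofReal (|⟪x, ξ⟫| ^ p)) x).toReal := by
  obtain ⟨L, hLm, hL1, hLn, hLi⟩ := exists_coord d ξ hξ
  have hsl : ∀ z : ℝ, μH[(d : ℝ)] (K ∩ {x : EuclideanSpace ℝ (Fin (d+1)) | ⟪x, ξ⟫ = z}) =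
      c * volume {y : EuclideanSpace ℝ (Fin d) | L (y, z) ∈ K} := by
    intro z
    have hiso : Isometry fun y : EuclideanSpace ℝ (Fin d) => L (y, z) := by
      apply Isometry.of_dist_eq
      intro y y'
      rw [dist_eq_norm, dist_eq_norm, ← map_sub, ← sq_eq_sq₀ (norm_nonneg _) (norm_nonneg _), hLn]
      simp
    have : K ∩ {x : EuclideanSpace ℝ (Fin (d+1)) | ⟪x, ξ⟫ = z} =
        (fun y : EuclideanSpace ℝ (Fin d) => L (y, z)) '' {y | L (y, z) ∈ K} := by
      ext x
      constructor
      · rintro ⟨h1, h2⟩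
        have h2 : ⟪x, ξ⟫ = z := h2
        have e : L ((L.symm x).1, z) = x := by
          have := hLi (L.symm x)
          rw [L.apply_symm_apply, h2] at this
          rw [this]; simp
        exact ⟨(L.symm x).1, by simpa only [mem_ofPred_eq, e] using h1, e⟩
      · rintro ⟨y, hy, rfl⟩
        exact ⟨hy, hLi (y, z)⟩
    rw [this, hiso.hausdorffMeasure_image (Or.inl (by positivity)), hc]
    rfl
  have hfin : ∀ z : ℝ, volume {y : EuclideanSpace ℝ (Fin d) | L (y, z) ∈ K} ≠ ⊤ := by
    intro z
    obtain ⟨R, hR⟩ := hK.isBounded.exists_norm_le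
    refine ((measure_mono ?_).trans_lt (measure_closedBall_lt_top (x := 0) (r := R))).ne
    intro y hy
    rw [mem_closedBall_zero_iff]
    refine le_trans ?_ (hR _ hy)
    apply abs_le_of_sq_le_sq' _ (norm_nonneg _) |>.2
    rw [hLn]; nlinarith [sq_nonneg z]
  have hKm := hK.measurableSet
  have hKL : MeasurableSet {p : EuclideanSpace ℝ (Fin d) × ℝ | L p ∈ K} := hLm.measurable hKm
  have hvm : Measurable fun z : ℝ => volume {y : EuclideanSpace ℝ (Fin d) | L (y, z) ∈ K} :=
    measurable_measure_prodMk_right hKL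
  simp only [hsl]
  have hFm : Measurable (K.indicator (fun x => ENNReal.ofReal (|⟪x, ξ⟫| ^ p))) :=
    Measurable.indicator (by fun_prop) hKm
  rw [integral_eq_lintegral_of_nonneg_ae]
  · congr 1
    have e : ∀ z : ℝ, ENNReal.ofReal (|z| ^ p *
        (c * volume {y : EuclideanSpace ℝ (Fin d) | L (y, z) ∈ K}).toReal) =
        c * (ENNReal.ofReal (|z| ^ p) * volume {y : EuclideanSpace ℝ (Fin d) | L (y, z) ∈ K}) := by
      intro z
      rw [ENNReal.ofReal_mul (by positivity), ENNReal.ofReal_toReal (ENNReal.mul_ne_top hct (hfin z))]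
      ring
    simp only [e]
    rw [lintegral_const_mul _ (by fun_prop), ← hLm.lintegral_comp hFm]
    rw [Measure.volume_eq_prod, lintegral_prod_symm _ (show Measurable fun a => K.indicator (fun x => ENNReal.ofReal (|⟪x, ξ⟫| ^ p)) (L a)
      from hFm.comp hLm.measurable).aemeasurable]
    congr 1
    apply lintegral_congr
    intro z
    have hm : MeasurableSet {y : EuclideanSpace ℝ (Fin d) | L (y, z) ∈ K} :=
      measurable_prodMk_right hKL
    rw [← lintegral_indicator_const hm]
    apply lintegral_congr
    intro y
    by_cases h : L (y, z) ∈ K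
    · rw [indicator_of_mem h, indicator_of_mem (by exact h), hLi]
    · rw [indicator_of_notMem h, indicator_of_notMem (by exact h)]
  · exact Filter.Eventually.of_forall fun z => by positivity
  · exact Measurable.aestronglyMeasurable (by fun_prop)

lemma radial_int (d : ℕ) (p R : ℝ) (hp : 0 < d + p + 1) (hR : 0 < R) :
    ∫⁻ r in Ioc 0 R, ENNReal.ofReal (r ^ d) * ENNReal.ofReal (r ^ p) =
      ENNReal.ofReal (R ^ (d + p + 1) / (d + p + 1)) := by
  have h1 : ∫⁻ r in Ioc 0 R, ENNReal.ofReal (r ^ d) * ENNReal.ofReal (r ^ p) =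
      ∫⁻ r in Ioc 0 R, ENNReal.ofReal (r ^ ((d : ℝ) + p)) := by
    apply setLIntegral_congr_fun measurableSet_Ioc
    intro r hr
    have hr0 : 0 < r := hr.1
    simp only
    rw [← ENNReal.ofReal_mul (by positivity), Real.rpow_add hr0, Real.rpow_natCast]
  have h2 : IntervalIntegrable (fun r : ℝ => r ^ ((d : ℝ) + p)) volume 0 R :=
    intervalIntegral.intervalIntegrable_rpow' (by linarith)
  rw [h1, ← ofReal_integral_eq_lintegral_ofReal h2.1, ← intervalIntegral.integral_of_le hR.le,
    integral_rpow (Or.inl (by linarith)), Real.zero_rpow hp.ne', sub_zero]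
  filter_upwards [ae_restrict_mem measurableSet_Ioc] with r hr
  exact Real.rpow_nonneg hr.1.le _

theorem section_function_moment (n : ℕ) (hn : 2 ≤ n)
    (K : Set (EuclideanSpace ℝ (Fin n)))
    (hKcomp : IsCompact K)
    (hKstar : ∀ x ∈ K, ∀ a : ℝ, a ∈ Icc (0 : ℝ) 1 → a • x ∈ K)
    (hK0 : (0 : EuclideanSpace ℝ (Fin n)) ∈ interior K)
    (hKsymm : K = -K)
    (ρ : EuclideanSpace ℝ (Fin n) → ℝ)
    (hρ : ∀ x : EuclideanSpace ℝ (Fin n), ‖x‖ = 1 →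
      IsGreatest {a : ℝ | 0 < a ∧ a • x ∈ K} (ρ x))
    (hρcont : ContinuousOn ρ (Metric.sphere (0 : EuclideanSpace ℝ (Fin n)) 1))
    (hρpos : ∀ x ∈ Metric.sphere (0 : EuclideanSpace ℝ (Fin n)) 1, 0 < ρ x)
    (q : ℝ) (hq1 : -1 < q) (hq2 : q < 0)
    (ξ : EuclideanSpace ℝ (Fin n)) (hξ : ‖ξ‖ = 1) :
    ∫ z : ℝ, |z| ^ (-q - 1) *
        (μH[(n : ℝ) - 1] (K ∩ {x : EuclideanSpace ℝ (Fin n) | ⟪x, ξ⟫ = z})).toReal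
      = (1 / ((n : ℝ) - q - 1)) *
          ∫ θ in Metric.sphere (0 : EuclideanSpace ℝ (Fin n)) 1,
            |⟪θ, ξ⟫| ^ (-q - 1) * ρ θ ^ ((n : ℝ) - q - 1) ∂μH[(n : ℝ) - 1] := by
  obtain ⟨d, rfl⟩ : ∃ d, n = d + 1 := ⟨n - 1, by omega⟩
  have e1 : ((d + 1 : ℕ) : ℝ) - 1 = d := by push_cast; ring
  have e2 : ((d + 1 : ℕ) : ℝ) - q - 1 = d + (-q - 1) + 1 := by push_cast; ring
  rw [e1, e2]
  have hd : (1 : ℝ) ≤ d := by exact_mod_cast (by omega : 1 ≤ d)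
  set p := -q - 1 with hp
  have hpos : 0 < (d : ℝ) + p + 1 := by linarith
  set m := (d : ℝ) + p + 1 with hm
  obtain ⟨c, hc0, hct, hc⟩ := hausdorff_eq d
  rw [slice_int d c hc hct K hKcomp p ξ hξ]
  rw [← integral_subtype_comap Metric.isClosed_sphere.measurableSet, sphere_measure d c hc]
  have hρm : Measurable fun θ : Metric.sphere (0 : EuclideanSpace ℝ (Fin (d+1))) 1 => ρ θ :=
    (continuousOn_iff_continuous_domRestrict.1 hρcont).measurable
  have hρp : ∀ θ : Metric.sphere (0 : EuclideanSpace ℝ (Fin (d+1))) 1, 0 < ρ θ :=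
    fun θ => hρpos θ θ.2
  have hFm : Measurable (K.indicator (fun x => ENNReal.ofReal (|⟪x, ξ⟫| ^ p))) :=
    Measurable.indicator (by fun_prop) hKcomp.measurableSet
  have hgm : Measurable fun θ : Metric.sphere (0 : EuclideanSpace ℝ (Fin (d+1))) 1 =>
      |⟪θ.1, ξ⟫| ^ p * ρ θ ^ m := by
    have h1 : Measurable fun θ : Metric.sphere (0 : EuclideanSpace ℝ (Fin (d+1))) 1 =>
      |⟪θ.1, ξ⟫| ^ p := by fun_prop
    exact h1.mul (hρm.pow_const m)
  rw [integral_eq_lintegral_of_nonneg_ae]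
  rotate_left
  · exact Filter.Eventually.of_forall fun θ =>
      mul_nonneg (by positivity) (Real.rpow_nonneg (hρp θ).le _)
  · exact hgm.aestronglyMeasurable
  rw [polar d _ hFm, lintegral_smul_measure, smul_eq_mul]
  have key : ∀ θ : Metric.sphere (0 : EuclideanSpace ℝ (Fin (d+1))) 1,
      (∫⁻ r in Ioi (0:ℝ), ENNReal.ofReal (r ^ d) *
        K.indicator (fun x => ENNReal.ofReal (|⟪x, ξ⟫| ^ p)) (r • θ.1)) =
      ENNReal.ofReal (1 / m) * ENNReal.ofReal (|⟪θ.1, ξ⟫| ^ p * ρ θ ^ m) := by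
    intro θ
    have hθ : ‖(θ : EuclideanSpace ℝ (Fin (d+1)))‖ = 1 := by simp
    have hmem : ∀ r : ℝ, 0 < r → (r • θ.1 ∈ K ↔ r ∈ Ioc 0 (ρ θ)) := by
      intro r hr
      constructor
      · intro h
        exact ⟨hr, (hρ θ hθ).2 ⟨hr, h⟩⟩
      · intro h
        have h1 := (hρ θ hθ).1.2
        have := hKstar _ h1 (r / ρ θ) ⟨by have := hρp θ; positivity, (div_le_one (hρp θ)).2 h.2⟩
        rwa [smul_smul, div_mul_cancel₀ _ (hρp θ).ne'] at this
    have h1 : ∫⁻ r in Ioi (0:ℝ), ENNReal.ofReal (r ^ d) *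
        K.indicator (fun x => ENNReal.ofReal (|⟪x, ξ⟫| ^ p)) (r • θ.1) =
        ∫⁻ r in Ioi (0:ℝ), (Ioc 0 (ρ θ)).indicator (fun r => ENNReal.ofReal (|⟪θ.1, ξ⟫| ^ p) *
          (ENNReal.ofReal (r ^ d) * ENNReal.ofReal (r ^ p))) r := by
      apply setLIntegral_congr_fun measurableSet_Ioi
      intro r hr
      have hr0 : 0 < r := hr
      by_cases h : r ∈ Ioc 0 (ρ θ)
      · simp only [indicator_of_mem h, indicator_of_mem ((hmem r hr).2 h)]
        rw [real_inner_smul_left, abs_mul, abs_of_pos hr0, Real.mul_rpow hr0.le (abs_nonneg _),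
          ENNReal.ofReal_mul (by positivity)]
        ring
      · simp only [indicator_of_notMem h, indicator_of_notMem (fun hh => h ((hmem r hr).1 hh)),
          mul_zero]
    rw [h1, lintegral_indicator measurableSet_Ioc, Measure.restrict_restrict measurableSet_Ioc,
      inter_eq_left.2 (fun x hx => hx.1), lintegral_const_mul _ (by fun_prop),
      radial_int d p _ hpos (hρp θ), ← ENNReal.ofReal_mul (by positivity),
      ← ENNReal.ofReal_mul (by positivity)]
    congr 1
    rw [← hm]
    ring
  simp only [key]
  rw [lintegral_const_mul _ hgm.ennreal_ofReal, mul_left_comm, ENNReal.toReal_mul,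
    ENNReal.toReal_ofReal (by positivity)]
end

section
/- Let n ≥ 1. For every even Schwartz function φ on ℝⁿ, every ξ ∈ S^{n−1}, and every real q with −1 < q < 0, ∫_{ℝⁿ} |⟨ξ, x⟩|^{−q−1} φ(x) dx = ( −1 / ( 2 Γ(1+q) sin(qπ/2) ) ) ∫_{−∞}^{∞} |t|^q φ̂(tξ) dt. -/
open MeasureTheory Set
open scoped RealInnerProductSpace Real

lemma aux_1d {a : ℝ} (h1 : -1 < a) (h2 : a < 0) :
    Integrable (fun t : ℝ => |t| ^ a * (1 + t ^ 2)⁻¹) := by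
  have hI : Integrable (fun t : ℝ => |t| ^ a * Real.exp (-|t|)) := by
    apply Integrable.of_integral_ne_zero
    rw [integral_comp_abs (f := fun t => t ^ a * Real.exp (-t))]
    have := Real.integral_rpow_mul_exp_neg_mul_Ioi (a := a + 1) (r := 1) (by linarith) one_pos
    simp only [add_sub_cancel_right, one_mul] at this
    rw [this]
    have := Real.Gamma_pos_of_pos (show 0 < a + 1 by linarith)
    simp [this.ne']
  refine ((hI.const_mul (Real.exp 1)).add integrable_inv_one_add_sq).mono'
    (by fun_prop) (Filter.Eventually.of_forall fun t => ?_)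
  have h0 : 0 ≤ |t| ^ a := by positivity
  have h3 : 0 < (1 + t ^ 2)⁻¹ := by positivity
  rw [Real.norm_of_nonneg (by positivity)]
  simp only [Pi.add_apply]
  rcases le_total |t| 1 with h | h
  · have h4 : (1 + t ^ 2)⁻¹ ≤ 1 := inv_le_one_of_one_le₀ (by nlinarith [sq_nonneg t])
    have h5 : 1 ≤ Real.exp 1 * Real.exp (-|t|) := by
      rw [← Real.exp_add]; exact Real.one_le_exp (by linarith)
    nlinarith [mul_le_mul_of_nonneg_left h4 h0, mul_le_mul_of_nonneg_left h5 h0]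
  · have h4 : |t| ^ a ≤ 1 := Real.rpow_le_one_of_one_le_of_nonpos h h2.le
    have : 0 ≤ Real.exp 1 * (|t| ^ a * Real.exp (-|t|)) := by positivity
    nlinarith [mul_le_mul_of_nonneg_right h4 h3.le]

lemma aux_decay {n : ℕ} (f : SchwartzMap (EuclideanSpace ℝ (Fin n)) ℂ) (k : ℕ) :
    ∃ C : ℝ, 0 ≤ C ∧ ∀ x, ‖f x‖ ≤ C * ((1 + ‖x‖ ^ 2) ^ k)⁻¹ := by
  refine ⟨2 ^ (2 * k) * (Finset.Iic (2 * k, 0)).sup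
    (fun m => SchwartzMap.seminorm ℝ m.1 m.2) f, by positivity, fun x => ?_⟩
  have := SchwartzMap.one_add_le_sup_seminorm_apply (𝕜 := ℝ) (m := (2 * k, 0)) (k := 2 * k) (n := 0)
    le_rfl le_rfl f x
  rw [norm_iteratedFDeriv_zero] at this
  have h2 : (1 + ‖x‖ ^ 2) ^ k ≤ (1 + ‖x‖) ^ (2 * k) := by
    rw [pow_mul]; gcongr; nlinarith [norm_nonneg x]
  rw [← div_eq_mul_inv, le_div_iff₀ (by positivity)]
  nlinarith [mul_le_mul_of_nonneg_left h2 (norm_nonneg (f x))]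

lemma aux_int_x {n : ℕ} (hn : 1 ≤ n) (f : SchwartzMap (EuclideanSpace ℝ (Fin n)) ℂ)
    (ξ : EuclideanSpace ℝ (Fin n)) (hξ : ‖ξ‖ = 1) {a : ℝ} (h1 : -1 < a) (h2 : a < 0) :
    Integrable (fun x => |⟪ξ, x⟫| ^ a • f x) := by
  obtain ⟨C, hC, hf⟩ := aux_decay f n
  let i0 : Fin n := ⟨0, hn⟩
  obtain ⟨b, hb⟩ := Orthonormal.exists_orthonormalBasis_extension_of_card_eq (𝕜 := ℝ)
    (E := EuclideanSpace ℝ (Fin n)) (ι := Fin n) (by simp) (v := fun _ => ξ) (s := {i0}) (by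
      rw [orthonormal_iff_ite]
      rintro ⟨i, hi⟩ ⟨j, hj⟩
      simp only [mem_singleton_iff] at hi hj
      subst hi; subst hj
      simp [hξ])
  have hb0 : b i0 = ξ := hb i0 rfl
  let g : Fin n → ℝ → ℝ := fun i t => (if i = i0 then |t| ^ a else 1) * (1 + t ^ 2)⁻¹
  have hg : Integrable (fun v : Fin n → ℝ => ∏ i, g i (v i)) := by
    apply Integrable.fintype_prod
    intro i
    by_cases h : i = i0
    · simpa [g, h] using aux_1d h1 h2
    · simpa [g, h] using integrable_inv_one_add_sq
  have hg2 : Integrable (fun v : EuclideanSpace ℝ (Fin n) => ∏ i, g i (v i)) :=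
    (PiLp.volume_preserving_ofLp (Fin n)).integrable_comp_of_integrable hg
  have hg3 : Integrable (fun x : EuclideanSpace ℝ (Fin n) => ∏ i, g i (b.repr x i)) :=
    (b.measurePreserving_repr).integrable_comp_of_integrable hg2
  refine (hg3.const_mul C).mono' ?_ (Filter.Eventually.of_forall fun x => ?_)
  · have := f.continuous
    have h : Measurable (fun x : EuclideanSpace ℝ (Fin n) => |⟪ξ, x⟫| ^ a) := by fun_prop
    exact h.aestronglyMeasurable.smul this.aestronglyMeasurable
  have e1 : ∏ i, g i (b.repr x i) = |⟪ξ, x⟫| ^ a * ∏ i, (1 + (b.repr x i) ^ 2)⁻¹ := by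
    simp only [g, Finset.prod_mul_distrib, Finset.prod_ite_eq', Finset.mem_univ, if_true]
    simp [b.repr_apply_apply, hb0]
  have e2 : ((1 + ‖x‖ ^ 2) ^ n)⁻¹ ≤ ∏ i, (1 + (b.repr x i) ^ 2)⁻¹ := by
    rw [Finset.prod_inv_distrib]
    apply inv_anti₀ (by positivity)
    calc ∏ i, (1 + (b.repr x i) ^ 2) ≤ ∏ i : Fin n, (1 + ‖x‖ ^ 2) := by
          apply Finset.prod_le_prod
          · intros; positivity
          · intro i _
            have := PiLp.norm_apply_le (b.repr x) i
            rw [b.repr.norm_map] at this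
            have h3 := pow_le_pow_left₀ (norm_nonneg _) this 2
            rw [Real.norm_eq_abs, sq_abs] at h3
            linarith
      _ = _ := by simp
  rw [norm_smul, Real.norm_of_nonneg (by positivity), e1]
  calc _ ≤ |⟪ξ, x⟫| ^ a * (C * ((1 + ‖x‖ ^ 2) ^ n)⁻¹) := by gcongr; exact hf x
    _ ≤ |⟪ξ, x⟫| ^ a * (C * ∏ i, (1 + (b.repr x i) ^ 2)⁻¹) := by gcongr
    _ = _ := by ring

open FourierTransform in
lemma aux_four {n : ℕ} (f : SchwartzMap (EuclideanSpace ℝ (Fin n)) ℂ)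
    (ξ : EuclideanSpace ℝ (Fin n)) (t : ℝ) :
    ∫ x : EuclideanSpace ℝ (Fin n), Complex.exp (Complex.I * (⟪x, t • ξ⟫ : ℂ)) * f x
      = (𝓕 f) ((-(t / (2 * π))) • ξ) := by
  rw [SchwartzMap.fourier_coe, Real.fourier_eq']
  refine integral_congr_ae (Filter.Eventually.of_forall fun x => ?_)
  simp only [inner_smul_right, smul_eq_mul]
  congr 2
  have : (π : ℂ) ≠ 0 := by exact_mod_cast Real.pi_ne_zero
  push_cast
  field_simp

open FourierTransform in
lemma aux_int_t {n : ℕ} (f : SchwartzMap (EuclideanSpace ℝ (Fin n)) ℂ)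
    (ξ : EuclideanSpace ℝ (Fin n)) (hξ : ‖ξ‖ = 1) {a : ℝ} (h1 : -1 < a) (h2 : a < 0) :
    Integrable (fun t : ℝ => |t| ^ a • ∫ x : EuclideanSpace ℝ (Fin n),
              Complex.exp (Complex.I * (⟪x, t • ξ⟫ : ℂ)) * f x) := by
  simp_rw [aux_four]
  obtain ⟨C, hC, hf⟩ := aux_decay (𝓕 f) 1
  refine ((aux_1d h1 h2).const_mul (C * (2 * π) ^ 2)).mono' ?_
    (Filter.Eventually.of_forall fun t => ?_)
  · have := (𝓕 f).continuous
    have h : Measurable (fun t : ℝ => |t| ^ a) := by fun_prop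
    have h' : Continuous (fun t : ℝ => (𝓕 f) ((-(t / (2 * π))) • ξ)) := by fun_prop
    exact h.aestronglyMeasurable.smul h'.aestronglyMeasurable
  rw [norm_smul, Real.norm_of_nonneg (by positivity)]
  have h := hf ((-(t / (2 * π))) • ξ)
  rw [norm_smul, hξ, mul_one, pow_one, Real.norm_eq_abs, sq_abs] at h
  have h3 : (1 + (-(t / (2 * π))) ^ 2)⁻¹ ≤ (2 * π) ^ 2 * (1 + t ^ 2)⁻¹ := by
    rw [← div_eq_mul_inv, le_div_iff₀ (by positivity), inv_mul_le_iff₀ (by positivity)]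
    have : (1 + (-(t / (2 * π))) ^ 2) * (2 * π) ^ 2 = (2 * π) ^ 2 + t ^ 2 := by
      field_simp
    rw [this]
    nlinarith [Real.pi_gt_three]
  calc _ ≤ |t| ^ a * (C * ((2 * π) ^ 2 * (1 + t ^ 2)⁻¹)) := by
        gcongr; exact h.trans (by gcongr)
    _ = _ := by ring

lemma aux_mix {α : Type*} [MeasurableSpace α] (μ : Measure α) [SFinite μ] (f : α → ℂ)
    (hf : AEStronglyMeasurable f μ)
    (k : ℝ → α → ℝ) (hk : Measurable (Function.uncurry k)) (hk0 : ∀ s ∈ Ioi (0:ℝ), ∀ a, 0 ≤ k s a)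
    (w : α → ℝ) (hw0 : ∀ᵐ a ∂μ, 0 < w a) (hw : ∀ᵐ a ∂μ, ∫ s in Ioi (0:ℝ), k s a = w a)
    (hi : Integrable (fun a => w a • f a) μ) :
    ∫ a, w a • f a ∂μ = ∫ s in Ioi (0:ℝ), ∫ a, k s a • f a ∂μ := by
  have hint : ∀ᵐ a ∂μ, IntegrableOn (fun s => k s a) (Ioi 0) := by
    filter_upwards [hw0, hw] with a h1 h2
    exact Integrable.of_integral_ne_zero (by rw [h2]; exact h1.ne')
  have key : Integrable (Function.uncurry fun s a => k s a • f a)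
      ((volume.restrict (Ioi (0:ℝ))).prod μ) := by
    rw [integrable_prod_iff']
    · constructor
      · filter_upwards [hint] with a h
        exact h.smul_const (f a)
      · refine hi.norm.congr ?_
        filter_upwards [hw0, hw] with a h0 h
        simp only [Function.uncurry_apply_pair, norm_smul]
        rw [integral_mul_const, Real.norm_of_nonneg h0.le, ← h]
        congr 1
        exact setIntegral_congr_fun measurableSet_Ioi
          (fun s hs => (Real.norm_of_nonneg (hk0 s hs a)).symm)
    · exact hk.aestronglyMeasurable.smul hf.comp_snd
  rw [integral_integral_swap key]
  refine integral_congr_ae ?_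
  filter_upwards [hw] with a h
  rw [integral_smul_const, h]

lemma aux_k1 {q t : ℝ} (hq2 : q < 0) (ht : t ≠ 0) :
    ∫ s in Ioi (0:ℝ), s ^ (-q / 2 - 1) * Real.exp (-(s * t ^ 2))
      = Real.Gamma (-q / 2) * |t| ^ q := by
  have := Real.integral_rpow_mul_exp_neg_mul_Ioi (a := -q/2) (r := t ^ 2) (by linarith)
    (by positivity)
  simp_rw [mul_comm _ (t ^ 2)]
  rw [this, mul_comm]
  congr 1
  rw [one_div, Real.inv_rpow (by positivity), ← Real.rpow_neg (by positivity), ← sq_abs,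
    ← Real.rpow_natCast, ← Real.rpow_mul (by positivity)]
  congr 1
  push_cast; ring

lemma aux_k2 {q u : ℝ} (hq1 : -1 < q) (hu : u ≠ 0) :
    ∫ s in Ioi (0:ℝ), s ^ (-q / 2 - 3 / 2) * Real.exp (-(u ^ 2 / (4 * s)))
      = Real.Gamma ((q + 1) / 2) * 2 ^ (q + 1) * |u| ^ (-q - 1) := by
  have h := Real.integral_rpow_mul_exp_neg_mul_Ioi (a := (q + 1)/2) (r := u ^ 2 / 4) (by linarith)
    (by positivity)
  rw [← integral_comp_rpow_Ioi _ (show (-1:ℝ) ≠ 0 by norm_num)] at h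
  have e : ∫ s in Ioi (0:ℝ), s ^ (-q / 2 - 3 / 2) * Real.exp (-(u ^ 2 / (4 * s))) =
      (1 / (u ^ 2 / 4)) ^ ((q + 1) / 2) * Real.Gamma ((q + 1) / 2) := by
    rw [← h]
    refine setIntegral_congr_fun measurableSet_Ioi (fun s hs => ?_)
    have hs : 0 < s := hs
    simp only [abs_neg, abs_one, one_mul, smul_eq_mul]
    rw [← mul_assoc, ← Real.rpow_mul hs.le, ← Real.rpow_add hs, Real.rpow_neg_one]
    congr 2
    · ring
    · field_simp
  rw [e, mul_comm, mul_assoc]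
  congr 1
  have : 1 / (u ^ 2 / 4) = (2 / |u|) ^ 2 := by
    rw [div_pow, sq_abs]; field_simp; norm_num
  rw [this, ← Real.rpow_natCast, ← Real.rpow_mul (by positivity),
    Real.div_rpow (by norm_num) (by positivity), show -q - 1 = -(q+1) by ring,
    Real.rpow_neg (by positivity), div_eq_mul_inv]
  congr 2
  · push_cast; ring
  · push_cast; ring_nf

lemma aux_const {q : ℝ} (hq1 : -1 < q) (hq2 : q < 0) :
    Real.Gamma (-q / 2) = (√π * Real.Gamma ((q + 1) / 2) * 2 ^ (q + 1)) *
      (-1 / (2 * Real.Gamma (1 + q) * Real.sin (q * π / 2))) := by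
  have h1 := Real.Gamma_mul_Gamma_one_sub (-q / 2)
  have h2 := Real.Gamma_mul_Gamma_add_half ((q + 1) / 2)
  have hs : Real.sin (q * π / 2) ≠ 0 := by
    apply ne_of_lt
    apply Real.sin_neg_of_neg_of_neg_pi_lt <;> nlinarith [Real.pi_pos]
  have hG := (Real.Gamma_pos_of_pos (show 0 < 1 + q by linarith)).ne'
  have hG2 := (Real.Gamma_pos_of_pos (show 0 < 1 + q / 2 by linarith)).ne'
  rw [show π * (-q / 2) = -(q * π / 2) by ring, Real.sin_neg,
    show 1 - -q / 2 = 1 + q / 2 by ring] at h1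
  rw [show (q + 1) / 2 + 1 / 2 = 1 + q / 2 by ring, show 2 * ((q + 1) / 2) = 1 + q by ring,
    show 1 - (1 + q) = -q by ring, Real.rpow_neg (by norm_num)] at h2
  rw [Real.rpow_add (by norm_num), Real.rpow_one]
  have hp : (2:ℝ) ^ q ≠ 0 := by positivity
  have hpi : √π * √π = π := Real.mul_self_sqrt Real.pi_pos.le
  apply mul_right_cancel₀ hG2
  rw [h1]
  have : √π * Real.Gamma ((q + 1) / 2) * (2 ^ q * 2) *
      (-1 / (2 * Real.Gamma (1 + q) * Real.sin (q * π / 2))) * Real.Gamma (1 + q / 2)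
      = √π * (Real.Gamma ((q + 1) / 2) * Real.Gamma (1 + q / 2)) * (2 ^ q * 2) *
      (-1 / (2 * Real.Gamma (1 + q) * Real.sin (q * π / 2))) := by ring
  have e : √π * (Real.Gamma (1 + q) * (2 ^ q)⁻¹ * √π) = π * (Real.Gamma (1 + q) * (2 ^ q)⁻¹) := by
    linear_combination (Real.Gamma (1 + q) * (2 ^ q)⁻¹) * hpi
  rw [this, h2, e]
  field_simp

lemma aux_gauss {n : ℕ} (f : SchwartzMap (EuclideanSpace ℝ (Fin n)) ℂ)
    (ξ : EuclideanSpace ℝ (Fin n)) {s : ℝ} (hs : 0 < s) :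
    ∫ t : ℝ, Real.exp (-(s * t ^ 2)) • ∫ x : EuclideanSpace ℝ (Fin n),
              Complex.exp (Complex.I * (⟪x, t • ξ⟫ : ℂ)) * f x
    = √(π / s) • ∫ x, Real.exp (-(⟪ξ, x⟫ ^ 2 / (4 * s))) • f x := by
  have hi : Integrable (Function.uncurry fun (t : ℝ) (x : EuclideanSpace ℝ (Fin n)) =>
      Real.exp (-(s * t ^ 2)) • (Complex.exp (Complex.I * (⟪x, t • ξ⟫ : ℂ)) * f x))
      (volume.prod volume) := by
    have h1 : Integrable (fun t : ℝ => Real.exp (-(s * t ^ 2))) := by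
      simpa using integrable_exp_neg_mul_sq hs
    have h2 := h1.smul_prod (f.integrable (μ := volume))
    refine h2.mono ?_ (Filter.Eventually.of_forall fun p => ?_)
    · have := f.continuous
      apply Continuous.aestronglyMeasurable
      unfold Function.uncurry
      fun_prop
    · simp only [Function.uncurry, norm_smul, norm_mul]
      rw [mul_comm Complex.I, Complex.norm_exp_ofReal_mul_I, one_mul]
  simp_rw [← integral_smul]
  rw [integral_integral_swap hi]
  refine integral_congr_ae (Filter.Eventually.of_forall fun x => ?_)
  have hG := fourierIntegral_gaussian (b := (s : ℂ)) (by simpa using hs) (⟪ξ, x⟫ : ℂ)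
  have e : ∀ t : ℝ, Real.exp (-(s * t ^ 2)) • (Complex.exp (Complex.I * (⟪x, t • ξ⟫ : ℂ)) * f x)
      = (Complex.exp (Complex.I * (⟪ξ, x⟫ : ℂ) * t) * Complex.exp (-s * t ^ 2)) * f x := by
    intro t
    rw [inner_smul_right, real_inner_comm, Complex.real_smul]
    push_cast
    ring_nf
  simp only [e]
  rw [integral_mul_const, hG, smul_smul, Complex.real_smul, Real.sqrt_eq_rpow]
  push_cast
  rw [Complex.ofReal_cpow (by positivity)]
  push_cast
  ring_nf

theorem lemma5 (n : ℕ) (hn : 1 ≤ n)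
    (φ : SchwartzMap (EuclideanSpace ℝ (Fin n)) ℂ)
    (hφ : ∀ x, φ (-x) = φ x)
    (ξ : EuclideanSpace ℝ (Fin n)) (hξ : ‖ξ‖ = 1)
    (q : ℝ) (hq1 : -1 < q) (hq2 : q < 0) :
    ∫ x : EuclideanSpace ℝ (Fin n), (|⟪ξ, x⟫| ^ (-q - 1)) • φ x
      = (-1 / (2 * Real.Gamma (1 + q) * Real.sin (q * π / 2))) •
          ∫ t : ℝ, (|t| ^ q) •
            ∫ x : EuclideanSpace ℝ (Fin n),
              Complex.exp (Complex.I * (⟪x, t • ξ⟫ : ℂ)) * φ x := by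
  have hG1 := Real.Gamma_pos_of_pos (show 0 < -q / 2 by linarith)
  have hG2 := Real.Gamma_pos_of_pos (show 0 < (q + 1) / 2 by linarith)
  set F : ℝ → ℂ := fun t => ∫ x : EuclideanSpace ℝ (Fin n),
              Complex.exp (Complex.I * (⟪x, t • ξ⟫ : ℂ)) * φ x with hF
  have hFm : AEStronglyMeasurable F volume := by
    rw [hF]; simp_rw [aux_four]
    have := (FourierTransform.fourier φ).continuous
    exact (Continuous.aestronglyMeasurable (by fun_prop))
  have ht0 : ∀ᵐ t : ℝ, t ≠ 0 := by
    simp [ae_iff]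
  have hx0 : ∀ᵐ x : EuclideanSpace ℝ (Fin n), ⟪ξ, x⟫ ≠ 0 := by
    have := Measure.addHaar_submodule (volume : Measure (EuclideanSpace ℝ (Fin n)))
      (LinearMap.ker (innerSL ℝ ξ).toLinearMap) (by
        intro h
        have : ξ ∈ LinearMap.ker (innerSL ℝ ξ).toLinearMap := h ▸ Submodule.mem_top
        simp at this
        simp [this] at hξ)
    rw [ae_iff]
    convert this using 2
    ext x; simp
  have A := aux_mix volume F hFm (fun s t => s ^ (-q / 2 - 1) * Real.exp (-(s * t ^ 2)))
    (by unfold Function.uncurry; fun_prop)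
    (fun s hs t => by have : 0 < s := hs; positivity)
    (fun t => Real.Gamma (-q / 2) * |t| ^ q)
    (by filter_upwards [ht0] with t ht; positivity)
    (by filter_upwards [ht0] with t ht using aux_k1 hq2 ht)
    (by simp only [mul_smul]; exact (aux_int_t φ ξ hξ hq1 hq2).smul (Real.Gamma (-q / 2)))
  have B := aux_mix volume φ φ.continuous.aestronglyMeasurable
    (fun s x => s ^ (-q / 2 - 3 / 2) * Real.exp (-(⟪ξ, x⟫ ^ 2 / (4 * s))))
    (by unfold Function.uncurry; fun_prop)
    (fun s hs t => by have : 0 < s := hs; positivity)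
    (fun x => Real.Gamma ((q + 1) / 2) * 2 ^ (q + 1) * |⟪ξ, x⟫| ^ (-q - 1))
    (by filter_upwards [hx0] with t ht; positivity)
    (by filter_upwards [hx0] with t ht using aux_k2 hq1 ht)
    (by simp only [mul_smul _ (|_| ^ _)]; exact (aux_int_x hn φ ξ hξ (a := -q - 1) (by linarith)
          (by linarith)).smul (Real.Gamma ((q + 1) / 2) * 2 ^ (q + 1)))
  have E : ∫ s in Ioi (0:ℝ), ∫ t, (s ^ (-q / 2 - 1) * Real.exp (-(s * t ^ 2))) • F t
      = √π • ∫ s in Ioi (0:ℝ), ∫ x,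
        (s ^ (-q / 2 - 3 / 2) * Real.exp (-(⟪ξ, x⟫ ^ 2 / (4 * s)))) • φ x := by
    rw [← integral_smul]
    refine setIntegral_congr_fun measurableSet_Ioi (fun s hs => ?_)
    have hs : 0 < s := hs
    simp only [mul_smul]
    rw [integral_smul, integral_smul, hF, aux_gauss φ ξ hs, smul_smul, smul_smul]
    congr 1
    rw [Real.sqrt_div Real.pi_pos.le, Real.sqrt_eq_rpow s,
      show -q / 2 - 3 / 2 = -q / 2 - 1 - 1 / 2 by ring, Real.rpow_sub hs (-q / 2 - 1)]
    ring
  rw [← A, ← B] at E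
  simp only [mul_smul, integral_smul] at E
  simp only [← mul_smul] at E
  have hc := aux_const hq1 hq2
  have hne : √π * (Real.Gamma ((q + 1) / 2) * 2 ^ (q + 1)) ≠ 0 := by positivity
  rw [← mul_assoc] at E hne
  rw [hc, mul_smul] at E
  exact (smul_right_injective ℂ hne E).symm
end

section
/- Every origin-symmetric convex body K in ℝ⁴ is an intersection body: there exists a finite non-negative Borel measure μ on the unit sphere S³ ⊂ ℝ⁴ such that for every continuous function f on S³, ∫_{S³} ρ_K(x) f(x) dx = ∫_{S³} ( ∫_{S³ ∩ ξ^⊥} f(x) dx ) dμ(ξ). -/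
section
open Filter Topology MeasureTheory Set
open scoped RealInnerProductSpace ENNReal NNReal

abbrev E4 := EuclideanSpace ℝ (Fin 4)

noncomputable def qm (x y : E4) : E4 :=
  !₂[x 0 * y 0 - x 1 * y 1 - x 2 * y 2 - x 3 * y 3,
     x 0 * y 1 + x 1 * y 0 + x 2 * y 3 - x 3 * y 2,
     x 0 * y 2 - x 1 * y 3 + x 2 * y 0 + x 3 * y 1,
     x 0 * y 3 + x 1 * y 2 - x 2 * y 1 + x 3 * y 0]

noncomputable def qc (x : E4) : E4 := !₂[x 0, - x 1, - x 2, - x 3]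

lemma qm0 (x y : E4) : qm x y 0 = x 0 * y 0 - x 1 * y 1 - x 2 * y 2 - x 3 * y 3 := rfl
lemma qm1 (x y : E4) : qm x y 1 = x 0 * y 1 + x 1 * y 0 + x 2 * y 3 - x 3 * y 2 := rfl
lemma qm2 (x y : E4) : qm x y 2 = x 0 * y 2 - x 1 * y 3 + x 2 * y 0 + x 3 * y 1 := rfl
lemma qm3 (x y : E4) : qm x y 3 = x 0 * y 3 + x 1 * y 2 - x 2 * y 1 + x 3 * y 0 := rfl
lemma qc0 (x : E4) : qc x 0 = x 0 := rfl
lemma qc1 (x : E4) : qc x 1 = - x 1 := rfl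
lemma qc2 (x : E4) : qc x 2 = - x 2 := rfl
lemma qc3 (x : E4) : qc x 3 = - x 3 := rfl

lemma nsq (x : E4) : ‖x‖ ^ 2 = x 0 ^ 2 + x 1 ^ 2 + x 2 ^ 2 + x 3 ^ 2 := by
  rw [EuclideanSpace.real_norm_sq_eq, Fin.sum_univ_four]

lemma inner4 (x y : E4) : ⟪x, y⟫ = x 0 * y 0 + x 1 * y 1 + x 2 * y 2 + x 3 * y 3 := by
  rw [PiLp.inner_apply, Fin.sum_univ_four]
  simp [mul_comm]

lemma ext4 {x y : E4} (h0 : x 0 = y 0) (h1 : x 1 = y 1) (h2 : x 2 = y 2) (h3 : x 3 = y 3) :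
    x = y := by
  ext i; fin_cases i <;> assumption

lemma norm_qm (x y : E4) : ‖qm x y‖ = ‖x‖ * ‖y‖ := by
  have : ‖qm x y‖ ^ 2 = (‖x‖ * ‖y‖) ^ 2 := by
    rw [mul_pow, nsq, nsq, nsq, qm0, qm1, qm2, qm3]; ring
  exact (pow_left_inj₀ (norm_nonneg _) (by positivity) two_ne_zero).1 this

lemma norm_qc (x : E4) : ‖qc x‖ = ‖x‖ := by
  have : ‖qc x‖ ^ 2 = ‖x‖ ^ 2 := by rw [nsq, nsq, qc0, qc1, qc2, qc3]; ring
  exact (pow_left_inj₀ (norm_nonneg _) (by positivity) two_ne_zero).1 this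

lemma qc_qc (x : E4) : qc (qc x) = x := by
  apply ext4 <;> simp [qc0, qc1, qc2, qc3]

lemma qc_qm {x : E4} (hx : ‖x‖ = 1) (y : E4) : qm (qc x) (qm x y) = y := by
  have h := nsq x
  rw [hx] at h
  apply ext4 <;> simp only [qm0, qm1, qm2, qm3, qc0, qc1, qc2, qc3]
  · linear_combination (-y 0) * h
  · linear_combination (-y 1) * h
  · linear_combination (-y 2) * h
  · linear_combination (-y 3) * h

lemma qm_qc {x : E4} (hx : ‖x‖ = 1) (y : E4) : qm x (qm (qc x) y) = y := by
  have := qc_qm (x := qc x) (by rw [norm_qc, hx]) y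
  rwa [qc_qc] at this

lemma qm_qm_qc {u : E4} (hu : ‖u‖ = 1) (x : E4) : qm (qm x u) (qc u) = x := by
  have h := nsq u
  rw [hu] at h
  apply ext4 <;> simp only [qm0, qm1, qm2, qm3, qc0, qc1, qc2, qc3]
  · linear_combination (-x 0) * h
  · linear_combination (-x 1) * h
  · linear_combination (-x 2) * h
  · linear_combination (-x 3) * h

lemma qm_qc_qm {u : E4} (hu : ‖u‖ = 1) (x : E4) : qm (qm x (qc u)) u = x := by
  have := qm_qm_qc (u := qc u) (by rw [norm_qc, hu]) x
  rwa [qc_qc] at this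

lemma inner_qm (x y u : E4) : ⟪y, qm x u⟫ = ⟪qm (qc x) y, u⟫ := by
  rw [inner4, inner4]; simp only [qm0, qm1, qm2, qm3, qc0, qc1, qc2, qc3]; ring

lemma qm_add_right (x y z : E4) : qm x (y + z) = qm x y + qm x z := by
  apply ext4 <;> simp only [qm0, qm1, qm2, qm3, PiLp.add_apply] <;> ring
lemma qm_smul_right (x : E4) (c : ℝ) (z : E4) : qm x (c • z) = c • qm x z := by
  apply ext4 <;> simp only [qm0, qm1, qm2, qm3, PiLp.smul_apply, smul_eq_mul] <;> ring
lemma qm_add_left (x y z : E4) : qm (x + y) z = qm x z + qm y z := by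
  apply ext4 <;> simp only [qm0, qm1, qm2, qm3, PiLp.add_apply] <;> ring
lemma qm_smul_left (x : E4) (c : ℝ) (z : E4) : qm (c • x) z = c • qm x z := by
  apply ext4 <;> simp only [qm0, qm1, qm2, qm3, PiLp.smul_apply, smul_eq_mul] <;> ring

noncomputable def lmul (x : E4) (hx : ‖x‖ = 1) : E4 ≃ₗᵢ[ℝ] E4 where
  toFun := qm x
  invFun := qm (qc x)
  map_add' := qm_add_right x
  map_smul' c z := qm_smul_right x c z
  left_inv := qc_qm hx
  right_inv := qm_qc hx
  norm_map' y := by change ‖qm x y‖ = ‖y‖; rw [norm_qm, hx, one_mul]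

noncomputable def rmul (u : E4) (hu : ‖u‖ = 1) : E4 ≃ₗᵢ[ℝ] E4 where
  toFun x := qm x u
  invFun x := qm x (qc u)
  map_add' x y := qm_add_left x y u
  map_smul' c z := qm_smul_left z c u
  left_inv := qm_qm_qc hu
  right_inv := qm_qc_qm hu
  norm_map' y := by change ‖qm y u‖ = ‖y‖; rw [norm_qm, hu, mul_one]

@[fun_prop]
lemma continuous_qm {X : Type*} [TopologicalSpace X] {f g : X → E4} (hf : Continuous f)
    (hg : Continuous g) : Continuous fun t => qm (f t) (g t) := by
  unfold qm
  refine (PiLp.continuous_toLp 2 _).comp (continuous_pi fun i => ?_)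
  fin_cases i <;> simp <;> fun_prop

@[fun_prop]
lemma continuous_qc {X : Type*} [TopologicalSpace X] {f : X → E4} (hf : Continuous f) :
    Continuous fun t => qc (f t) := by
  unfold qc
  refine (PiLp.continuous_toLp 2 _).comp (continuous_pi fun i => ?_)
  fin_cases i <;> simp <;> fun_prop

/-- sphere and its equator -/
noncomputable abbrev S3 : Set E4 := Metric.sphere (0 : E4) 1
def S2 : Set E4 := Metric.sphere (0 : E4) 1 ∩ {x | x 0 = 0}

noncomputable def sg : Measure E4 := (μH[3] : Measure E4).restrict (Metric.sphere (0 : E4) 1)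
noncomputable def ta : Measure E4 := (μH[2] : Measure E4).restrict S2

lemma isClosed_S2 : IsClosed S2 :=
  Metric.isClosed_sphere.inter (isClosed_eq (by fun_prop) continuous_const)

lemma radon_eq (f : E4 → ℝ) {ξ : E4} (hξ : ‖ξ‖ = 1) :
    (∫ x in Metric.sphere (0 : E4) 1 ∩ {x : E4 | ⟪x, ξ⟫ = 0}, f x ∂μH[2])
      = ∫ u, f (qm ξ u) ∂ta := by
  have hmp := (lmul ξ hξ).toIsometryEquiv.measurePreserving_hausdorffMeasure 2
  have := hmp.setIntegral_preimage_emb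
    (lmul ξ hξ).toHomeomorph.measurableEmbedding f
    (Metric.sphere (0 : E4) 1 ∩ {x : E4 | ⟪x, ξ⟫ = 0})
  rw [← this, ta]
  have hs : S2 = (lmul ξ hξ).toIsometryEquiv ⁻¹'
      (Metric.sphere (0 : E4) 1 ∩ {x : E4 | ⟪x, ξ⟫ = 0}) := by
    ext u
    have h1 : ((lmul ξ hξ).toIsometryEquiv u) = qm ξ u := rfl
    have h2 : ⟪qm ξ u, ξ⟫ = u 0 := by
      have h := nsq ξ
      rw [hξ] at h
      rw [inner4]; simp only [qm0, qm1, qm2, qm3]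
      linear_combination (-u 0) * h
    simp only [S2, mem_inter_iff, mem_preimage, h1, mem_sphere_iff_norm, sub_zero, norm_qm, hξ,
      one_mul, Set.mem_ofPred_eq, h2]
  rw [hs]
  rfl

lemma sg_right_inv (f : E4 → ℝ) {u : E4} (hu : ‖u‖ = 1) :
    ∫ ξ, f (qm ξ u) ∂sg = ∫ ξ, f ξ ∂sg := by
  have hmp := (rmul u hu).toIsometryEquiv.measurePreserving_hausdorffMeasure 3
  have := hmp.setIntegral_preimage_emb
    (rmul u hu).toHomeomorph.measurableEmbedding f (Metric.sphere (0 : E4) 1)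
  rw [sg, ← this]
  have hs : Metric.sphere (0 : E4) 1 = (rmul u hu).toIsometryEquiv ⁻¹'
      (Metric.sphere (0 : E4) 1) := by
    ext x
    have h1 : ((rmul u hu).toIsometryEquiv x) = qm x u := rfl
    simp only [mem_preimage, h1, mem_sphere_iff_norm, sub_zero, norm_qm, hu, mul_one]
  rw [← hs]
  rfl


lemma polar_exists (p q : ℝ) : ∃ b ∈ Icc (-Real.pi) Real.pi,
    p = √(p ^ 2 + q ^ 2) * Real.cos b ∧ q = √(p ^ 2 + q ^ 2) * Real.sin b := by
  have h := Complex.norm_eq_sqrt_sq_add_sq (⟨p, q⟩ : ℂ)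
  refine ⟨Complex.arg ⟨p, q⟩, ⟨(Complex.neg_pi_lt_arg _).le, Complex.arg_le_pi _⟩, ?_, ?_⟩
  · have := Complex.norm_mul_cos_arg (⟨p, q⟩ : ℂ)
    rw [h] at this; exact this.symm
  · have := Complex.norm_mul_sin_arg (⟨p, q⟩ : ℂ)
    rw [h] at this; exact this.symm

lemma hausdorff_image_box_lt_top {d : ℕ} (F : (Fin d → ℝ) → E4) (hF : ContDiff ℝ 1 F) (s : Set E4)
    (hs : s ⊆ F '' (Set.pi univ fun _ => Icc (-Real.pi) Real.pi)) : μH[d] s < ∞ := by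
  have hcomp : IsCompact (Set.pi univ fun _ : Fin d => Icc (-Real.pi) Real.pi) :=
    isCompact_univ_pi fun _ => isCompact_Icc
  obtain ⟨C, hC⟩ := hF.contDiffOn.exists_lipschitzOnWith one_ne_zero
    (convex_pi fun _ _ => convex_Icc _ _) hcomp
  calc μH[d] s ≤ μH[d] (F '' (Set.pi univ fun _ => Icc (-Real.pi) Real.pi)) := measure_mono hs
    _ ≤ (C : ℝ≥0∞) ^ (d : ℝ) * μH[d] (Set.pi univ fun _ : Fin d => Icc (-Real.pi) Real.pi) :=
        hC.hausdorffMeasure_image_le (by positivity)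
    _ < ∞ := by
        have : (μH[d] : Measure (Fin d → ℝ)) = volume := by
          have := hausdorffMeasure_pi_real (ι := Fin d)
          rwa [Fintype.card_fin] at this
        rw [this]
        exact ENNReal.mul_lt_top (by simp) hcomp.measure_lt_top

lemma h3_lt_top : (μH[3] : Measure E4) (Metric.sphere (0 : E4) 1) < ∞ := by
  have := hausdorff_image_box_lt_top (d := 3)
    (fun v => !₂[Real.cos (v 0) * Real.cos (v 1), Real.cos (v 0) * Real.sin (v 1),
      Real.sin (v 0) * Real.cos (v 2), Real.sin (v 0) * Real.sin (v 2)]) ?_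
      (Metric.sphere (0 : E4) 1) ?_
  · simpa using this
  · rw [contDiff_euclidean]
    intro i; fin_cases i <;> simp <;> fun_prop
  · intro x hx
    rw [mem_sphere_iff_norm, sub_zero] at hx
    have hn := nsq x
    rw [hx] at hn
    obtain ⟨b, hb, hb1, hb2⟩ := polar_exists (x 0) (x 1)
    obtain ⟨c, hc, hc1, hc2⟩ := polar_exists (x 2) (x 3)
    obtain ⟨a, ha, ha1, ha2⟩ := polar_exists (√(x 0 ^ 2 + x 1 ^ 2)) (√(x 2 ^ 2 + x 3 ^ 2))
    have h1 : √((√(x 0 ^ 2 + x 1 ^ 2)) ^ 2 + (√(x 2 ^ 2 + x 3 ^ 2)) ^ 2) = 1 := by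
      rw [Real.sq_sqrt (by positivity), Real.sq_sqrt (by positivity)]
      rw [show x 0 ^ 2 + x 1 ^ 2 + (x 2 ^ 2 + x 3 ^ 2) = 1 by linarith, Real.sqrt_one]
    rw [h1, one_mul] at ha1 ha2
    refine ⟨![a, b, c], ?_, ?_⟩
    · intro i _; fin_cases i <;> assumption
    · apply ext4 <;> simp
      · rw [← ha1, ← hb1]
      · rw [← ha1, ← hb2]
      · rw [← ha2, ← hc1]
      · rw [← ha2, ← hc2]

lemma h2_lt_top : (μH[2] : Measure E4) S2 < ∞ := by
  have := hausdorff_image_box_lt_top (d := 2)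
    (fun v => !₂[0, Real.cos (v 0),
      Real.sin (v 0) * Real.cos (v 1), Real.sin (v 0) * Real.sin (v 1)]) ?_
      S2 ?_
  · simpa using this
  · rw [contDiff_euclidean]
    intro i; fin_cases i <;> simp <;> fun_prop
  · rintro x ⟨hx, hx0⟩
    rw [mem_sphere_iff_norm, sub_zero] at hx
    have hx0 : x 0 = 0 := hx0
    have hn := nsq x
    rw [hx, hx0] at hn
    obtain ⟨c, hc, hc1, hc2⟩ := polar_exists (x 2) (x 3)
    obtain ⟨a, ha, ha1, ha2⟩ := polar_exists (x 1) (√(x 2 ^ 2 + x 3 ^ 2))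
    have h1 : √((x 1) ^ 2 + (√(x 2 ^ 2 + x 3 ^ 2)) ^ 2) = 1 := by
      rw [Real.sq_sqrt (by positivity)]
      rw [show x 1 ^ 2 + (x 2 ^ 2 + x 3 ^ 2) = 1 by linarith, Real.sqrt_one]
    rw [h1, one_mul] at ha1 ha2
    refine ⟨![a, c], ?_, ?_⟩
    · intro i _; fin_cases i <;> assumption
    · apply ext4 <;> simp
      · exact hx0.symm
      · exact ha1.symm
      · rw [← ha2, ← hc1]
      · rw [← ha2, ← hc2]

lemma h2_pos : 0 < (μH[2] : Measure E4) S2 := by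
  have hL : LipschitzWith 1 (fun x : E4 => (![x 2, x 3] : Fin 2 → ℝ)) := by
    refine LipschitzWith.of_dist_le_mul fun x y => ?_
    rw [NNReal.coe_one, one_mul, dist_pi_le_iff dist_nonneg, dist_eq_norm x y]
    intro i
    fin_cases i
    · simpa [Real.dist_eq] using PiLp.norm_apply_le (x - y) 2
    · simpa [Real.dist_eq] using PiLp.norm_apply_le (x - y) 3
  have h1 := hL.hausdorffMeasure_image_le (d := 2) (by norm_num) S2
  have h2 : (μH[2] : Measure (Fin 2 → ℝ)) = volume := by
    have := hausdorffMeasure_pi_real (ι := Fin 2)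
    simpa using this
  rw [h2] at h1
  have h3 : Metric.ball (0 : Fin 2 → ℝ) (1 / 2) ⊆ (fun x : E4 => (![x 2, x 3] : Fin 2 → ℝ)) '' S2 := by
    intro v hv
    rw [mem_ball_zero_iff, pi_norm_lt_iff (by norm_num)] at hv
    have a := hv 0
    have b := hv 1
    rw [Real.norm_eq_abs, abs_lt] at a b
    have hp : 0 ≤ 1 - v 0 ^ 2 - v 1 ^ 2 := by nlinarith
    refine ⟨!₂[0, √(1 - v 0 ^ 2 - v 1 ^ 2), v 0, v 1], ⟨?_, rfl⟩, ?_⟩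
    · rw [mem_sphere_iff_norm, sub_zero, ← sq_eq_sq₀ (norm_nonneg _) zero_le_one, nsq]
      simp [Real.sq_sqrt hp]; ring
    · ext i; fin_cases i <;> rfl
  have h4 : 0 < volume (Metric.ball (0 : Fin 2 → ℝ) (1 / 2)) :=
    Metric.measure_ball_pos _ _ (by norm_num)
  have h5 := (h4.trans_le (measure_mono h3)).trans_le h1
  simpa using h5

instance : IsFiniteMeasure sg := ⟨by rw [sg, Measure.restrict_apply_univ]; exact h3_lt_top⟩
instance : IsFiniteMeasure ta := ⟨by rw [ta, Measure.restrict_apply_univ]; exact h2_lt_top⟩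

lemma ta_pos : 0 < ta.real univ := by
  rw [Measure.real, ENNReal.toReal_pos_iff]
  exact ⟨by rw [ta, Measure.restrict_apply_univ]; exact h2_pos, measure_lt_top _ _⟩

lemma ae_sg : ∀ᵐ x ∂sg, ‖x‖ = 1 := by
  filter_upwards [ae_restrict_mem (μ := (μH[3] : Measure E4))
    (Metric.isClosed_sphere (x := (0 : E4)) (ε := 1)).measurableSet] with x hx
  simpa using hx

lemma ae_ta : ∀ᵐ x ∂ta, ‖x‖ = 1 ∧ x 0 = 0 := by
  filter_upwards [ae_restrict_mem (μ := (μH[2] : Measure E4)) isClosed_S2.measurableSet] with x hx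
  exact ⟨by simpa using hx.1, hx.2⟩


lemma isCompact_S2 : IsCompact S2 :=
  (isCompact_sphere (0 : E4) 1).inter_right (isClosed_eq (by fun_prop) continuous_const)

lemma integrable_ta {f : E4 → ℝ} (hf : Continuous f) : Integrable f ta := by
  have h := hf.continuousOn.integrableOn_compact' (μ := ta) isCompact_S2 isClosed_S2.measurableSet
  rw [IntegrableOn, ta, Measure.restrict_restrict isClosed_S2.measurableSet, inter_self] at h
  exact h

lemma deriv_int (k D : ℝ → E4 → ℝ) (hk : ∀ θ, Continuous (k θ))
    (hD : Continuous (fun p : ℝ × E4 => D p.1 p.2))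
    (h : ∀ θ u, HasDerivAt (fun t => k t u) (D θ u) θ) (θ₀ : ℝ) :
    HasDerivAt (fun θ => ∫ u, k θ u ∂ta) (∫ u, D θ₀ u ∂ta) θ₀ := by
  obtain ⟨C, hC⟩ := ((isCompact_closedBall θ₀ 1).prod isCompact_S2).exists_bound_of_continuousOn
    hD.continuousOn
  refine (hasDerivAt_integral_of_dominated_loc_of_deriv_le (F := k) (F' := D)
    (bound := fun _ => C) (Metric.closedBall_mem_nhds θ₀ one_pos) (Eventually.of_forall fun θ =>
      (hk θ).aestronglyMeasurable) (integrable_ta (hk θ₀)) ?_ ?_ (integrable_const _) ?_).2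
  · exact (hD.comp (by fun_prop : Continuous fun u : E4 => (θ₀, u))).aestronglyMeasurable
  · filter_upwards [ae_restrict_mem (μ := (μH[2] : Measure E4)) isClosed_S2.measurableSet] with u hu
    intro θ hθ
    exact hC (θ, u) ⟨hθ, hu⟩
  · exact Eventually.of_forall fun u θ _ => h θ u

noncomputable def qe (a : E4) (θ : ℝ) : E4 := !₂[Real.cos θ, Real.sin θ * a 1, Real.sin θ * a 2,
  Real.sin θ * a 3]
lemma qe0 (a : E4) (θ : ℝ) : qe a θ 0 = Real.cos θ := rfl
lemma qe1 (a : E4) (θ : ℝ) : qe a θ 1 = Real.sin θ * a 1 := rfl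
lemma qe2 (a : E4) (θ : ℝ) : qe a θ 2 = Real.sin θ * a 2 := rfl
lemma qe3 (a : E4) (θ : ℝ) : qe a θ 3 = Real.sin θ * a 3 := rfl

lemma norm_qe {a : E4} (ha : ‖a‖ = 1) (ha0 : a 0 = 0) (θ : ℝ) : ‖qe a θ‖ = 1 := by
  rw [← sq_eq_sq₀ (norm_nonneg _) zero_le_one, nsq, qe0, qe1, qe2, qe3]
  have := nsq a
  rw [ha, ha0] at this
  have h2 := Real.sin_sq_add_cos_sq θ
  linear_combination h2 - Real.sin θ ^ 2 * this

noncomputable def rot (a : E4) (θ : ℝ) (u : E4) : E4 := qm (qm (qe a θ) u) (qc (qe a θ))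

lemma ta_rot {a : E4} (ha : ‖a‖ = 1) (ha0 : a 0 = 0) (θ : ℝ) (f : E4 → ℝ) :
    ∫ u, f (rot a θ u) ∂ta = ∫ u, f u ∂ta := by
  have hq := norm_qe ha ha0 θ
  set e := (lmul (qe a θ) hq).trans (rmul (qc (qe a θ)) (by rw [norm_qc, hq])) with he
  have hmp := e.toIsometryEquiv.measurePreserving_hausdorffMeasure 2
  have := hmp.setIntegral_preimage_emb e.toHomeomorph.measurableEmbedding f S2
  rw [ta, ← this]
  have hs : S2 = e.toIsometryEquiv ⁻¹' S2 := by
    ext x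
    have h1 : (e.toIsometryEquiv x) = rot a θ x := rfl
    have h2 : (rot a θ x) 0 = x 0 := by
      have h := nsq (qe a θ)
      rw [hq] at h
      simp only [rot, qm0, qm1, qm2, qm3, qc0, qc1, qc2, qc3]
      linear_combination (-x 0) * h
    have h3 : ‖rot a θ x‖ = ‖x‖ := by
      rw [rot, norm_qm, norm_qm, norm_qc, hq, one_mul, mul_one]
    simp only [S2, mem_inter_iff, mem_preimage, h1, mem_sphere_iff_norm, sub_zero, h3,
      Set.mem_ofPred_eq, h2]
  rw [← hs]
  rfl

noncomputable def m1 (a u : E4) : E4 := qm a u - qm u a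
noncomputable def m2 (a u : E4) : E4 := - qm (qm a u) a

lemma inner_rot {a : E4} (ha0 : a 0 = 0) (θ : ℝ) (z u : E4) : ⟪z, rot a θ u⟫ =
    Real.cos θ ^ 2 * ⟪z, u⟫ + Real.sin θ * Real.cos θ * ⟪z, m1 a u⟫ + Real.sin θ ^ 2 * ⟪z, m2 a u⟫ := by
  simp only [inner4, rot, m1, m2, qm0, qm1, qm2, qm3, qc0, qc1, qc2, qc3, qe0, qe1, qe2, qe3,
    PiLp.sub_apply, PiLp.neg_apply, ha0]
  ring

lemma inner_m1_rot {a : E4} (ha0 : a 0 = 0) (θ : ℝ) (z u : E4) : ⟪z, m1 a (rot a θ u)⟫ =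
    Real.cos θ ^ 2 * ⟪z, m1 a u⟫ + Real.sin θ * Real.cos θ * ⟪z, m1 a (m1 a u)⟫
      + Real.sin θ ^ 2 * ⟪z, m1 a (m2 a u)⟫ := by
  simp only [inner4, rot, m1, m2, qm0, qm1, qm2, qm3, qc0, qc1, qc2, qc3, qe0, qe1, qe2, qe3,
    PiLp.sub_apply, PiLp.neg_apply, ha0]
  ring

@[fun_prop]
lemma continuous_m1 {X : Type*} [TopologicalSpace X] {f g : X → E4} (hf : Continuous f)
    (hg : Continuous g) : Continuous fun t => m1 (f t) (g t) := by
  unfold m1; fun_prop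
@[fun_prop]
lemma continuous_m2 {X : Type*} [TopologicalSpace X] {f g : X → E4} (hf : Continuous f)
    (hg : Continuous g) : Continuous fun t => m2 (f t) (g t) := by
  unfold m2; fun_prop

lemma hasDerivAt_quad (A B C θ : ℝ) :
    HasDerivAt (fun t => Real.cos t ^ 2 * A + Real.sin t * Real.cos t * B + Real.sin t ^ 2 * C)
      (-2 * Real.cos θ * Real.sin θ * A + (Real.cos θ ^ 2 - Real.sin θ ^ 2) * B
        + 2 * Real.sin θ * Real.cos θ * C) θ := by
  have hc := Real.hasDerivAt_cos θ
  have hs := Real.hasDerivAt_sin θ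
  refine ((((hc.fun_pow 2).mul_const A).fun_add ((hs.fun_mul hc).mul_const B)).fun_add
    ((hs.fun_pow 2).mul_const C)).congr_deriv ?_
  push_cast; ring

lemma rot_identity {a : E4} (ha : ‖a‖ = 1) (ha0 : a 0 = 0) (z : E4) (F F' : ℝ → ℝ)
    (hF : ∀ t, HasDerivAt F (F' t) t) (hF' : Continuous F') :
    ∫ u, (F' ⟪z, u⟫ * ⟪z, m1 a u⟫ ^ 2 + F ⟪z, u⟫ * ⟪z, m1 a (m1 a u)⟫) ∂ta = 0 := by
  have hFc : Continuous F := continuous_iff_continuousAt.2 fun t => (hF t).continuousAt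
  set P : ℝ → E4 → ℝ := fun θ u => Real.cos θ ^ 2 * ⟪z, u⟫ + Real.sin θ * Real.cos θ * ⟪z, m1 a u⟫
    + Real.sin θ ^ 2 * ⟪z, m2 a u⟫ with hP
  set Q : ℝ → E4 → ℝ := fun θ u => Real.cos θ ^ 2 * ⟪z, m1 a u⟫
    + Real.sin θ * Real.cos θ * ⟪z, m1 a (m1 a u)⟫ + Real.sin θ ^ 2 * ⟪z, m1 a (m2 a u)⟫ with hQ
  set P' : ℝ → E4 → ℝ := fun θ u => -2 * Real.cos θ * Real.sin θ * ⟪z, u⟫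
    + (Real.cos θ ^ 2 - Real.sin θ ^ 2) * ⟪z, m1 a u⟫
        + 2 * Real.sin θ * Real.cos θ * ⟪z, m2 a u⟫ with hP'
  set Q' : ℝ → E4 → ℝ := fun θ u => -2 * Real.cos θ * Real.sin θ * ⟪z, m1 a u⟫
    + (Real.cos θ ^ 2 - Real.sin θ ^ 2) * ⟪z, m1 a (m1 a u)⟫
        + 2 * Real.sin θ * Real.cos θ * ⟪z, m1 a (m2 a u)⟫ with hQ'
  have key := deriv_int (fun θ u => F (P θ u) * Q θ u)
    (fun θ u => (F' (P θ u) * P' θ u) * Q θ u + F (P θ u) * Q' θ u)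
    (fun θ => by simp only [hP, hQ]; fun_prop)
    (by simp only [hP, hQ, hP', hQ']; fun_prop)
    (fun θ u => ((hF _).comp θ (hasDerivAt_quad _ _ _ θ)).mul (hasDerivAt_quad _ _ _ θ)) 0
  have hconst : (fun θ => ∫ u, F (P θ u) * Q θ u ∂ta)
      = fun _ => ∫ u, F ⟪z, u⟫ * ⟪z, m1 a u⟫ ∂ta := by
    funext θ
    rw [← ta_rot ha ha0 θ (fun u => F ⟪z, u⟫ * ⟪z, m1 a u⟫)]
    simp only [inner_rot ha0, inner_m1_rot ha0, hP, hQ]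
  rw [hconst] at key
  have h0 := key.unique (hasDerivAt_const 0 _)
  rw [← h0]
  congr 1
  funext u
  simp [hP, hQ, hP', hQ']
  ring

lemma sphere_identity (z : E4) (F F' : ℝ → ℝ)
    (hF : ∀ t, HasDerivAt F (F' t) t) (hF' : Continuous F') :
    ∫ u, ((‖z‖ ^ 2 - z 0 ^ 2 - ⟪z, u⟫ ^ 2) * F' ⟪z, u⟫ - 2 * ⟪z, u⟫ * F ⟪z, u⟫) ∂ta = 0 := by
  have hFc : Continuous F := continuous_iff_continuousAt.2 fun t => (hF t).continuousAt
  have e1 := rot_identity (a := !₂[0, 1, 0, 0]) (by rw [← sq_eq_sq₀ (norm_nonneg _) zero_le_one, nsq]; simp) rfl z F F' hF hF'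
  have e2 := rot_identity (a := !₂[0, 0, 1, 0]) (by rw [← sq_eq_sq₀ (norm_nonneg _) zero_le_one, nsq]; simp) rfl z F F' hF hF'
  have e3 := rot_identity (a := !₂[0, 0, 0, 1]) (by rw [← sq_eq_sq₀ (norm_nonneg _) zero_le_one, nsq]; simp) rfl z F F' hF hF'
  have i : ∀ a : E4, Integrable
    (fun u => F' ⟪z, u⟫ * ⟪z, m1 a u⟫ ^ 2 + F ⟪z, u⟫ * ⟪z, m1 a (m1 a u)⟫) ta :=
    fun a => integrable_ta (by fun_prop)
  have hsum := congrArg₂ (· + ·) (congrArg₂ (· + ·) e1 e2) e3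
  rw [← integral_add (i _) (i _), ← integral_add ((i _).fun_add (i _)) (i _)] at hsum
  have h4 : ∫ u, ((‖z‖ ^ 2 - z 0 ^ 2 - ⟪z, u⟫ ^ 2) * F' ⟪z, u⟫ - 2 * ⟪z, u⟫ * F ⟪z, u⟫) ∂ta
    = (1/4) * 0 := by
    rw [show (0 : ℝ) = 0 + 0 + 0 by simp, ← hsum, ← integral_const_mul]
    refine integral_congr_ae ?_
    filter_upwards [ae_ta] with u hu
    have hn := nsq u
    rw [hu.1, hu.2] at hn
    have hz := nsq z
    generalize hp : ⟪z, u⟫ = p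
    have hp' : p = z 1 * u 1 + z 2 * u 2 + z 3 * u 3 := by
      rw [← hp, inner4, hu.2]; ring
    simp only [inner4, m1, qm0, qm1, qm2, qm3, PiLp.sub_apply, hu.2]
    simp [Matrix.vecHead, Matrix.vecTail]
    rw [hz]
    generalize F p = A
    generalize F' p = B
    rw [hp']
    linear_combination ((z 1) ^ 2 + (z 2) ^ 2 + (z 3) ^ 2) * B * hn
  rw [h4, mul_zero]

noncomputable def ph (t : ℝ) : ℝ := (1 - 2 * t ^ 2) * Real.exp (-t ^ 2)

lemma hasDerivAt_gexp (t : ℝ) : HasDerivAt (fun t : ℝ => Real.exp (-t ^ 2))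
    (-2 * t * Real.exp (-t ^ 2)) t := by
  refine ((hasDerivAt_id' t).fun_pow 2).fun_neg.exp.congr_deriv ?_
  simp; ring

lemma hasDerivAt_Ph (t : ℝ) : HasDerivAt (fun t : ℝ => t * Real.exp (-t ^ 2)) (ph t) t := by
  refine ((hasDerivAt_id' t).fun_mul (hasDerivAt_gexp t)).congr_deriv ?_
  simp [ph]; ring

lemma hasDerivAt_ph (t : ℝ) : HasDerivAt ph ((4 * t ^ 3 - 6 * t) * Real.exp (-t ^ 2)) t := by
  refine (((((hasDerivAt_id' t).fun_pow 2).const_mul 2).const_sub 1).fun_mul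
    (hasDerivAt_gexp t)).congr_deriv ?_
  simp; ring

@[fun_prop]
lemma continuous_ph : Continuous ph := by unfold ph; fun_prop

lemma archimedes (z : E4) :
    ∫ u, ph ⟪z, u⟫ ∂ta = ta.real univ * Real.exp (-(‖z‖ ^ 2 - z 0 ^ 2)) := by
  set R := ‖z‖ ^ 2 - z 0 ^ 2 with hR
  have hJ := deriv_int (fun s u => ph (s * ⟪z, u⟫))
    (fun s u => ((4 * (s * ⟪z, u⟫) ^ 3 - 6 * (s * ⟪z, u⟫)) * Real.exp (-(s * ⟪z, u⟫) ^ 2)) * ⟪z, u⟫)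
    (fun s => by fun_prop) (by fun_prop)
    (fun s u => (hasDerivAt_ph _).comp s (by simpa using (hasDerivAt_id s).mul_const ⟪z, u⟫))
  set J : ℝ → ℝ := fun s => ∫ u, ph (s * ⟪z, u⟫) ∂ta with hJdef
  have hJ' : ∀ s, HasDerivAt J (-2 * s * R * J s) s := by
    intro s
    convert hJ s using 1
    have hid := sphere_identity z (fun p => p * Real.exp (-(s * p) ^ 2))
      (fun p => (1 - 2 * s ^ 2 * p ^ 2) * Real.exp (-(s * p) ^ 2)) (fun t => by
        have h1 : HasDerivAt (fun t : ℝ => s * t) s t := by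
          simpa using (hasDerivAt_id t).const_mul s
        refine ((hasDerivAt_id' t).fun_mul ((hasDerivAt_gexp (s * t)).comp t h1)).congr_deriv ?_
        simp; ring) (by fun_prop)
    rw [hJdef]
    have i1 : Integrable (fun u => ph (s * ⟪z, u⟫)) ta := integrable_ta (by fun_prop)
    rw [← integral_const_mul, ← sub_eq_zero, ← integral_sub (i1.const_mul _)
      (integrable_ta (by fun_prop))]
    rw [← mul_zero (-2 * s), ← hid, ← integral_const_mul]
    congr 1
    funext u
    simp only [ph]
    rw [← hR]
    ring
  have hconst : ∀ s, HasDerivAt (fun s => J s * Real.exp (s ^ 2 * R)) 0 s := by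
    intro s
    have h2 : HasDerivAt (fun s : ℝ => Real.exp (s ^ 2 * R)) (Real.exp (s ^ 2 * R) * (2 * s * R)) s := by
      refine (((hasDerivAt_id' s).fun_pow 2).mul_const R).exp.congr_deriv ?_
      simp
    refine ((hJ' s).fun_mul h2).congr_deriv ?_
    ring
  have heq := is_const_of_deriv_eq_zero (fun s => (hconst s).differentiableAt)
    (fun s => (hconst s).deriv) 1 0
  have hJ0 : J 0 = ta.real univ := by simp [hJdef, ph]
  simp only [hJ0] at heq
  have hJ1 : J 1 = ∫ u, ph ⟪z, u⟫ ∂ta := by simp [hJdef]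
  rw [← hJ1]
  simp at heq
  rw [Real.exp_neg, ← heq]
  field_simp


abbrev V4 := Fin 4 → ℝ

def slc (K : Set V4) (i : Fin 4) (y : Fin 3 → ℝ) : Set ℝ := {t | Fin.insertNth (α := fun _ => ℝ) i t y ∈ K}

lemma continuous_ins (i : Fin 4) : Continuous (fun p : ℝ × (Fin 3 → ℝ) => Fin.insertNth (α := fun _ => ℝ) i p.1 p.2) := by
  fun_prop

lemma isClosed_slc {K : Set V4} (hK : IsCompact K) (i : Fin 4) (y : Fin 3 → ℝ) :
    IsClosed (slc K i y) :=
  hK.isClosed.preimage ((continuous_ins i).comp (by fun_prop : Continuous fun t : ℝ => (t, y)))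

lemma integral_slc {K : Set V4} (hK : IsCompact K) (i : Fin 4) (f : V4 → ℝ) (hf : Continuous f) :
    ∫ x in K, f x = ∫ y : Fin 3 → ℝ, ∫ t in slc K i y, f (Fin.insertNth (α := fun _ => ℝ) i t y) := by
  have hint : Integrable (K.indicator f) :=
    (integrable_indicator_iff hK.measurableSet).2 (hf.continuousOn.integrableOn_compact hK)
  have hmp := (volume_preserving_piFinSuccAbove (fun _ : Fin 4 => ℝ) i).symm
  rw [← integral_indicator hK.measurableSet, ← hmp.integral_comp']
  rw [Measure.volume_eq_prod, integral_prod_symm]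
  · congr 1
    funext y
    rw [← integral_indicator (isClosed_slc hK i y).measurableSet]
    rfl
  · exact (hmp.integrable_comp_emb (MeasurableEquiv.measurableEmbedding _)).2 hint

lemma isCompact_slc {K : Set V4} (hK : IsCompact K) (i : Fin 4) (y : Fin 3 → ℝ) :
    IsCompact (slc K i y) := by
  refine (hK.image (continuous_apply i)).of_isClosed_subset (isClosed_slc hK i y) ?_
  intro t ht
  exact ⟨_, ht, by simp⟩

lemma convex_slc {K : Set V4} (hK : Convex ℝ K) (i : Fin 4) (y : Fin 3 → ℝ) :
    Convex ℝ (slc K i y) := by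
  intro s hs t ht a b ha hb hab
  have := hK hs ht ha hb hab
  simp only [slc, Set.mem_ofPred_eq]
  convert this using 1
  ext j
  refine Fin.succAboveCases i ?_ (fun j => ?_) j
  · simp
  · simp [← add_mul, hab]

lemma interval_cases' {T : Set ℝ} (hT : IsCompact T) (hc : Convex ℝ T) :
    T = ∅ ∨ ∃ α β, α ≤ β ∧ T = Icc α β := by
  rcases T.eq_empty_or_nonempty with h | h
  · exact Or.inl h
  · right
    have := eq_Icc_of_connected_compact ⟨h, hc.isPreconnected⟩ hT
    exact ⟨_, _, nonempty_Icc.1 (this ▸ h), this⟩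

def st (i : Fin 4) (K : Set V4) : Set V4 :=
  {x | ∃ a b, x i = (a - b) / 2 ∧ Function.update x i a ∈ K ∧ Function.update x i b ∈ K}

lemma st_eq (i : Fin 4) (K : Set V4) : st i K =
    (fun p : V4 × V4 => Function.update p.1 i ((p.1 i - p.2 i) / 2)) ''
      ((K ×ˢ K) ∩ {p | ∀ j, j ≠ i → p.1 j = p.2 j}) := by
  ext x
  constructor
  · rintro ⟨a, b, h, ha, hb⟩
    refine ⟨(Function.update x i a, Function.update x i b), ⟨⟨ha, hb⟩, fun j hj => by simp [hj]⟩, ?_⟩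
    simp [← h]
  · rintro ⟨⟨p, q⟩, ⟨⟨hp, hq⟩, h⟩, rfl⟩
    refine ⟨p i, q i, by simp, by simpa using hp, ?_⟩
    convert hq using 1
    ext j
    by_cases hj : j = i
    · subst hj; simp
    · simpa [hj] using h j hj

lemma isCompact_st {K : Set V4} (hK : IsCompact K) (i : Fin 4) : IsCompact (st i K) := by
  rw [st_eq]
  refine ((hK.prod hK).inter_right ?_).image ?_
  · simp only [Set.ofPred_forall]
    exact isClosed_iInter fun j => isClosed_iInter fun _ => isClosed_eq (by fun_prop) (by fun_prop)
  · exact continuous_fst.update i (by fun_prop)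

lemma update_comb (x y : V4) (i : Fin 4) (s t a b : ℝ) :
    Function.update (s • x + t • y) i (s * a + t * b)
      = s • Function.update x i a + t • Function.update y i b := by
  ext j
  by_cases hj : j = i
  · subst hj; simp
  · simp [hj]

lemma convex_st {K : Set V4} (hK : Convex ℝ K) (i : Fin 4) : Convex ℝ (st i K) := by
  rintro x ⟨a, b, h, ha, hb⟩ y ⟨a', b', h', ha', hb'⟩ s t hs ht hst
  refine ⟨s * a + t * a', s * b + t * b', ?_, ?_, ?_⟩
  · simp [h, h']; ring
  · rw [update_comb]; exact hK ha ha' hs ht hst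
  · rw [update_comb]; exact hK hb hb' hs ht hst

lemma update_neg (x : V4) (i : Fin 4) (a : ℝ) :
    Function.update (-x) i (-a) = - Function.update x i a := by
  ext j
  by_cases hj : j = i
  · subst hj; simp
  · simp [hj]

lemma neg_st {K : Set V4} (hK : ∀ x ∈ K, -x ∈ K) (i : Fin 4) : ∀ x ∈ st i K, -x ∈ st i K := by
  rintro x ⟨a, b, h, ha, hb⟩
  refine ⟨-a, -b, ?_, ?_, ?_⟩
  · simp [h]; ring
  · rw [update_neg]; exact hK _ ha
  · rw [update_neg]; exact hK _ hb

lemma refl_st_self (K : Set V4) (i : Fin 4) :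
    ∀ x ∈ st i K, Function.update x i (- x i) ∈ st i K := by
  rintro x ⟨a, b, h, ha, hb⟩
  exact ⟨b, a, by simp [h]; ring, by simpa using hb, by simpa using ha⟩

lemma refl_st {K : Set V4} {i j : Fin 4} (hij : i ≠ j)
    (hK : ∀ x ∈ K, Function.update x j (- x j) ∈ K) :
    ∀ x ∈ st i K, Function.update x j (- x j) ∈ st i K := by
  rintro x ⟨a, b, h, ha, hb⟩
  refine ⟨a, b, by simp [hij, h], ?_, ?_⟩
  · have := hK _ ha
    rw [Function.update_comm hij.symm]
    simpa [hij.symm] using this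
  · have := hK _ hb
    rw [Function.update_comm hij.symm]
    simpa [hij.symm] using this

lemma slc_st (K : Set V4) (i : Fin 4) (y : Fin 3 → ℝ) :
    slc (st i K) i y = {t | ∃ a ∈ slc K i y, ∃ b ∈ slc K i y, t = (a - b) / 2} := by
  ext t
  simp only [slc, st, Set.mem_ofPred_eq, Fin.insertNth_apply_same, Fin.update_insertNth]
  constructor
  · rintro ⟨a, b, h, ha, hb⟩; exact ⟨a, ha, b, hb, h⟩
  · rintro ⟨a, ha, b, hb, h⟩; exact ⟨a, b, h, ha, hb⟩

lemma vol_slc_st {K : Set V4} (hK : IsCompact K) (hc : Convex ℝ K) (i : Fin 4) (y : Fin 3 → ℝ) :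
    volume (slc (st i K) i y) = volume (slc K i y) := by
  rw [slc_st]
  rcases interval_cases' (isCompact_slc hK i y) (convex_slc hc i y) with h | ⟨α, β, hab, h⟩
  · rw [h]; simp
  · rw [h]
    have : {t | ∃ a ∈ Icc α β, ∃ b ∈ Icc α β, t = (a - b) / 2} = Icc (-((β - α) / 2)) ((β - α) / 2) := by
      ext t
      simp only [Set.mem_ofPred_eq, mem_Icc]
      constructor
      · rintro ⟨a, ⟨_, _⟩, b, ⟨_, _⟩, rfl⟩; constructor <;> linarith
      · rintro ⟨h1, h2⟩
        exact ⟨(α + β) / 2 + t, ⟨by linarith, by linarith⟩, (α + β) / 2 - t,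
          ⟨by linarith, by linarith⟩, by ring⟩
    rw [this, Real.volume_Icc, Real.volume_Icc]
    congr 1; ring

lemma integral_st {K : Set V4} (hK : IsCompact K) (hc : Convex ℝ K) {i : Fin 4} (hi : i ≠ 0)
    (ψ : ℝ → ℝ) (hψ : Continuous ψ) :
    ∫ x in st i K, ψ (x 0) = ∫ x in K, ψ (x 0) := by
  rw [integral_slc (isCompact_st hK i) i (fun x => ψ (x 0)) (by fun_prop), integral_slc hK i (fun x => ψ (x 0)) (by fun_prop)]
  congr 1
  funext y
  have h0 : ∀ t, (Fin.insertNth (α := fun _ => ℝ) i t y : V4) 0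
      = (Fin.insertNth (α := fun _ => ℝ) i 0 y : V4) 0 := by
    intro t
    obtain ⟨j, hj⟩ := Fin.exists_succAbove_eq hi.symm
    rw [← hj]; simp
  simp_rw [h0]
  simp only [setIntegral_const, Measure.real, vol_slc_st hK hc i y]

lemma integral_nonneg_of_symm {K : Set V4} (hK : IsCompact K) (hc : Convex ℝ K)
    (hs : ∀ x ∈ K, -x ∈ K) (ψ : ℝ → ℝ) (hψ : Continuous ψ)
    (hψ0 : ∀ s, 0 ≤ s → 0 ≤ ∫ t in Icc (-s) s, ψ t) :
    0 ≤ ∫ x in K, ψ (x 0) := by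
  have k1 := isCompact_st hK 1
  have k2 := isCompact_st k1 2
  have k3 := isCompact_st k2 3
  have c1 := convex_st hc 1
  have c2 := convex_st c1 2
  have c3 := convex_st c2 3
  rw [← integral_st hK hc (i := 1) (by decide) ψ hψ, ← integral_st k1 c1 (i := 2) (by decide) ψ hψ,
    ← integral_st k2 c2 (i := 3) (by decide) ψ hψ]
  have r3 := refl_st_self (st 2 (st 1 K)) 3
  have r2 := refl_st (i := 3) (j := 2) (by decide) (refl_st_self (st 1 K) 2)
  have r1 := refl_st (i := 3) (j := 1) (by decide)
    (refl_st (i := 2) (j := 1) (by decide) (refl_st_self K 1))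
  have s3 := neg_st (neg_st (neg_st hs 1) 2) 3
  set L := st 3 (st 2 (st 1 K))
  have r0 : ∀ x ∈ L, Function.update x 0 (- x 0) ∈ L := by
    intro x hx
    have := s3 _ (r1 _ (r2 _ (r3 _ hx)))
    convert this using 1
    ext j
    fin_cases j <;> simp [Function.update]
  rw [integral_slc k3 0 (fun x => ψ (x 0)) (by fun_prop)]
  refine integral_nonneg fun y => ?_
  simp only [Fin.insertNth_apply_same]
  rcases interval_cases' (isCompact_slc k3 0 y) (convex_slc c3 0 y) with h | ⟨α, β, hab, h⟩
  · rw [h]; simp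
  · have hsym : ∀ t ∈ slc L 0 y, -t ∈ slc L 0 y := by
      intro t ht
      have := r0 _ ht
      rwa [Fin.insertNth_apply_same, Fin.update_insertNth] at this
    rw [h] at hsym
    have h1 := hsym α ⟨le_rfl, hab⟩
    have h2 := hsym β ⟨hab, le_rfl⟩
    have h3 : α = -β := by
      have := h1.2; have := h2.1; linarith
    rw [h, h3]
    exact hψ0 β (by linarith)

lemma ph_int {ε : ℝ} (hε : 0 < ε) (s : ℝ) (hs : 0 ≤ s) : 0 ≤ ∫ t in Icc (-s) s, ph (t / ε) := by
  rw [integral_Icc_eq_integral_Ioc, ← intervalIntegral.integral_of_le (by linarith)]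
  have hd : ∀ t, HasDerivAt (fun t : ℝ => ε * ((t / ε) * Real.exp (-(t / ε) ^ 2))) (ph (t / ε)) t := by
    intro t
    refine (((hasDerivAt_Ph (t / ε)).comp t ((hasDerivAt_id' t).div_const ε)).const_mul ε).congr_deriv ?_
    field_simp
  rw [intervalIntegral.integral_eq_sub_of_hasDerivAt (fun t _ => hd t)
    (Continuous.intervalIntegrable (by fun_prop) _ _)]
  have : (-s / ε) ^ 2 = (s / ε) ^ 2 := by ring
  rw [this]
  have : 0 ≤ ε * (s / ε * Real.exp (-(s / ε) ^ 2)) := by positivity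
  have h2 : ε * (-s / ε * Real.exp (-(s / ε) ^ 2)) = - (ε * (s / ε * Real.exp (-(s / ε) ^ 2))) := by
    ring
  linarith


noncomputable def ce (ξ : E4) (w : V4) : E4 := qm ξ (WithLp.toLp 2 w)

def Kx (K : Set E4) (ξ : E4) : Set V4 := ce ξ ⁻¹' K

@[fun_prop]
lemma continuous_ce (ξ : E4) : Continuous (ce ξ) := by unfold ce; fun_prop

lemma mp_ce {ξ : E4} (hξ : ‖ξ‖ = 1) : MeasurePreserving (ce ξ) :=
  (lmul ξ hξ).measurePreserving.comp (PiLp.volume_preserving_toLp (Fin 4))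

lemma emb_ce {ξ : E4} (hξ : ‖ξ‖ = 1) : MeasurableEmbedding (ce ξ) :=
  (lmul ξ hξ).toHomeomorph.measurableEmbedding.comp
    (MeasurableEquiv.toLp 2 (Fin 4 → ℝ)).measurableEmbedding

lemma integral_Kx (K : Set E4) {ξ : E4} (hξ : ‖ξ‖ = 1) (f : E4 → ℝ) :
    ∫ y in K, f y = ∫ w in Kx K ξ, f (ce ξ w) :=
  ((mp_ce hξ).setIntegral_preimage_emb (emb_ce hξ) f K).symm

lemma norm_ce {ξ : E4} (hξ : ‖ξ‖ = 1) (w : V4) :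
    ‖ce ξ w‖ ^ 2 = w 0 ^ 2 + w 1 ^ 2 + w 2 ^ 2 + w 3 ^ 2 := by
  rw [ce, norm_qm, hξ, one_mul, nsq]

lemma inner_ce {ξ : E4} (hξ : ‖ξ‖ = 1) (w : V4) : ⟪ce ξ w, ξ⟫ = w 0 := by
  have h := nsq ξ
  rw [hξ] at h
  rw [inner4]; simp only [ce, qm0, qm1, qm2, qm3]
  linear_combination (-w 0) * h

lemma isCompact_Kx {K : Set E4} (hK : IsCompact K) {ξ : E4} (hξ : ‖ξ‖ = 1) :
    IsCompact (Kx K ξ) := by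
  have : Kx K ξ = WithLp.ofLp '' ((lmul ξ hξ).symm '' K) := by
    ext w
    constructor
    · intro hw
      exact ⟨WithLp.toLp 2 w, ⟨_, hw, (lmul ξ hξ).symm_apply_apply _⟩, rfl⟩
    · rintro ⟨_, ⟨y, hy, rfl⟩, rfl⟩
      have : ce ξ (WithLp.ofLp ((lmul ξ hξ).symm y)) = y := (lmul ξ hξ).apply_symm_apply y
      change ce ξ _ ∈ K
      rwa [this]
  rw [this]
  exact (hK.image (lmul ξ hξ).symm.continuous).image (PiLp.continuous_ofLp 2 _)

lemma convex_Kx {K : Set E4} (hK : Convex ℝ K) (ξ : E4) : Convex ℝ (Kx K ξ) := by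
  intro x hx y hy a b ha hb hab
  have := hK hx hy ha hb hab
  change ce ξ _ ∈ K
  convert this using 1
  simp only [ce, ← qm_smul_right, ← qm_add_right]
  rfl

lemma neg_Kx {K : Set E4} (hK : K = -K) (ξ : E4) : ∀ x ∈ Kx K ξ, -x ∈ Kx K ξ := by
  intro x hx
  change ce ξ (-x) ∈ K
  have : ce ξ (-x) = - ce ξ x := by
    have := qm_smul_right ξ (-1) (WithLp.toLp 2 x)
    rw [neg_one_smul, neg_one_smul] at this
    exact this
  have hx2 : ce ξ x ∈ K := hx
  rw [this]
  rw [hK] at hx2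
  exact hx2

/-- the approximating density is nonnegative -/
lemma g_nonneg {K : Set E4} (hKcomp : IsCompact K) (hKconv : Convex ℝ K) (hKsymm : K = -K)
    {ξ : E4} (hξ : ‖ξ‖ = 1) {ε : ℝ} (hε : 0 < ε) : 0 ≤ ∫ y in K, ph (⟪y, ξ⟫ / ε) := by
  rw [integral_Kx K hξ]
  simp_rw [inner_ce hξ]
  exact integral_nonneg_of_symm (isCompact_Kx hKcomp hξ) (convex_Kx hKconv ξ) (neg_Kx hKsymm ξ)
    (fun t => ph (t / ε)) (by fun_prop) (ph_int hε)

noncomputable def Pn (K : Set E4) (ε : ℝ) (ξ : E4) : ℝ :=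
  (ε ^ 3)⁻¹ * ∫ y in K, Real.exp (-((‖y‖ ^ 2 - ⟪y, ξ⟫ ^ 2) / ε ^ 2))

noncomputable def gw (z : Fin 3 → ℝ) : ℝ := Real.exp (-(z 0 ^ 2 + z 1 ^ 2 + z 2 ^ 2))

lemma integrable_gw : Integrable gw := by
  have h := Integrable.fintype_prod (ι := Fin 3) (μ := fun _ => (volume : Measure ℝ))
    (f := fun _ x => Real.exp (-1 * x ^ 2)) (fun _ => integrable_exp_neg_mul_sq one_pos)
  refine h.congr (Eventually.of_forall fun z => ?_)
  simp only [Fin.prod_univ_three, gw, ← Real.exp_add]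
  congr 1; ring

lemma gw_nonneg (z : Fin 3 → ℝ) : 0 ≤ gw z := (Real.exp_pos _).le

lemma gw_pos : 0 < ∫ z, gw z := by
  rw [integral_pos_iff_support_of_nonneg (f := gw) gw_nonneg integrable_gw]
  have : Function.support gw = univ := by
    ext z; simp [gw, Real.exp_ne_zero]
  rw [this]; simp

lemma Pn_eq {K : Set E4} (hK : IsCompact K) {ξ : E4} (hξ : ‖ξ‖ = 1) {ε : ℝ} (hε : 0 < ε) :
    Pn K ε ξ = ∫ z, volume.real (slc (Kx K ξ) 0 (ε • z)) * gw z := by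
  have h1 : ∫ y in K, Real.exp (-((‖y‖ ^ 2 - ⟪y, ξ⟫ ^ 2) / ε ^ 2))
      = ∫ z, volume.real (slc (Kx K ξ) 0 z) * gw (ε⁻¹ • z) := by
    rw [integral_Kx K hξ, integral_slc (isCompact_Kx hK hξ) 0 _ (by fun_prop)]
    congr 1
    funext z
    rw [← smul_eq_mul, ← setIntegral_const]
    congr 1
    funext t
    rw [norm_ce hξ, inner_ce hξ, gw]
    congr 1
    have e0 : (Fin.insertNth (α := fun _ => ℝ) 0 t z : V4) 1 = z 0 := rfl
    have e1 : (Fin.insertNth (α := fun _ => ℝ) 0 t z : V4) 2 = z 1 := rfl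
    have e2 : (Fin.insertNth (α := fun _ => ℝ) 0 t z : V4) 3 = z 2 := rfl
    rw [e0, e1, e2]
    simp only [Pi.smul_apply, smul_eq_mul]
    field_simp
    ring
  have h2 := Measure.integral_comp_smul (volume : Measure (Fin 3 → ℝ))
    (fun z => volume.real (slc (Kx K ξ) 0 z) * gw (ε⁻¹ • z)) ε
  rw [Pn, h1]
  simp only [Module.finrank_fintype_fun_eq_card, Fintype.card_fin, smul_eq_mul] at h2
  rw [abs_of_pos (by positivity)] at h2
  rw [← h2]
  congr 1
  funext z
  rw [smul_smul, inv_mul_cancel₀ hε.ne', one_smul]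

lemma slc_subset {K : Set E4} {M : ℝ} (hM : ∀ x ∈ K, ‖x‖ ≤ M) {ξ : E4} (hξ : ‖ξ‖ = 1)
    (z : Fin 3 → ℝ) : slc (Kx K ξ) 0 z ⊆ Icc (-M) M := by
  intro t ht
  have h1 : ‖ce ξ (Fin.insertNth (α := fun _ => ℝ) 0 t z)‖ ≤ M := hM _ ht
  have h2 := abs_real_inner_le_norm (ce ξ (Fin.insertNth (α := fun _ => ℝ) 0 t z)) ξ
  rw [inner_ce hξ, hξ, mul_one, Fin.insertNth_apply_same] at h2
  exact abs_le.1 (h2.trans h1)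

lemma vol_slc_le {K : Set E4} {M : ℝ} (hM0 : 0 ≤ M) (hM : ∀ x ∈ K, ‖x‖ ≤ M) {ξ : E4} (hξ : ‖ξ‖ = 1)
    (z : Fin 3 → ℝ) : volume.real (slc (Kx K ξ) 0 z) ≤ 2 * M := by
  calc _ ≤ volume.real (Icc (-M) M) :=
        measureReal_mono (slc_subset hM hξ z) (by simp)
    _ = 2 * M := by rw [Real.volume_real_Icc_of_le (by linarith)]; ring

lemma measurable_slc {K : Set E4} (hK : IsCompact K) {ξ : E4} (hξ : ‖ξ‖ = 1) :
    Measurable fun z => volume.real (slc (Kx K ξ) 0 z) := by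
  have : MeasurableSet ((fun p : ℝ × (Fin 3 → ℝ) => Fin.insertNth (α := fun _ => ℝ) 0 p.1 p.2) ⁻¹'
      (Kx K ξ)) := ((isCompact_Kx hK hξ).isClosed.preimage (continuous_ins 0)).measurableSet
  exact (measurable_measure_prodMk_right (μ := (volume : Measure ℝ)) this).ennreal_toReal

lemma Pn_bound {K : Set E4} (hK : IsCompact K) {M : ℝ} (hM0 : 0 ≤ M) (hM : ∀ x ∈ K, ‖x‖ ≤ M)
    {ξ : E4} (hξ : ‖ξ‖ = 1) {ε : ℝ} (hε : 0 < ε) : ‖Pn K ε ξ‖ ≤ 2 * M * ∫ z, gw z := by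
  rw [Pn_eq hK hξ hε, ← integral_const_mul]
  refine norm_integral_le_of_norm_le (integrable_gw.const_mul _) (Eventually.of_forall fun z => ?_)
  have := gw_nonneg z
  rw [norm_mul, Real.norm_of_nonneg measureReal_nonneg, Real.norm_of_nonneg this]
  exact mul_le_mul_of_nonneg_right (vol_slc_le hM0 hM hξ _) this

lemma slc_tendsto {K : Set E4} (hKcomp : IsCompact K) (hKconv : Convex ℝ K)
    (h0 : (0 : E4) ∈ interior K) (hKsymm : K = -K) {ξ : E4} (hξ : ‖ξ‖ = 1) {r : ℝ}
    (hr : IsGreatest {a : ℝ | 0 < a ∧ a • ξ ∈ K} r) (z : Fin 3 → ℝ) (ε : ℕ → ℝ)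
    (hε : Tendsto ε atTop (𝓝 0)) :
    Tendsto (fun n => volume.real (slc (Kx K ξ) 0 (ε n • z))) atTop (𝓝 (2 * r)) := by
  obtain ⟨M, hM⟩ := hKcomp.isBounded.exists_norm_le
  have hrp : 0 < r := hr.1.1
  have hrK : r • ξ ∈ K := hr.1.2
  have hneg : ∀ y, y ∈ K → -y ∈ K := fun y hy => by rw [hKsymm]; simpa using hy
  have key : Tendsto (fun n => ∫ t, (slc (Kx K ξ) 0 (ε n • z)).indicator (fun _ => (1 : ℝ)) t) atTop
      (𝓝 (∫ t, (Icc (-r) r).indicator (fun _ => (1 : ℝ)) t)) := by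
    refine tendsto_integral_of_dominated_convergence ((Icc (-M) M).indicator fun _ => (1 : ℝ))
      (fun n => ?_) ?_ (fun n => ?_) ?_
    · exact (aestronglyMeasurable_const).indicator
        (isClosed_slc (isCompact_Kx hKcomp hξ) 0 _).measurableSet
    · exact (integrable_indicator_iff measurableSet_Icc).2 (by simp [IntegrableOn])
    · refine Eventually.of_forall fun t => ?_
      by_cases ht : t ∈ slc (Kx K ξ) 0 (ε n • z)
      · rw [indicator_of_mem ht, indicator_of_mem (slc_subset hM hξ _ ht)]; simp
      · rw [indicator_of_notMem ht]; simp [indicator_nonneg]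
    · have hnull : ∀ᵐ t : ℝ, t ≠ r ∧ t ≠ -r := by
        have h1 : ∀ᵐ t : ℝ, t ≠ r := by simp [ae_iff]
        have h2 : ∀ᵐ t : ℝ, t ≠ -r := by simp [ae_iff]
        filter_upwards [h1, h2] with t a b using ⟨a, b⟩
      filter_upwards [hnull] with t ht
      have hlim : Tendsto (fun n => ce ξ (Fin.insertNth (α := fun _ => ℝ) 0 t (ε n • z))) atTop
          (𝓝 (t • ξ)) := by
        have hc : Continuous fun e : ℝ => ce ξ (Fin.insertNth (α := fun _ => ℝ) 0 t (e • z)) :=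
          (continuous_ce ξ).comp ((continuous_ins 0).comp (by fun_prop :
            Continuous fun e : ℝ => (t, e • z)))
        have h1 := (hc.tendsto 0).comp hε
        have h2 : ce ξ (Fin.insertNth (α := fun _ => ℝ) 0 t ((0 : ℝ) • z)) = t • ξ := by
          rw [zero_smul]
          have e0 : (Fin.insertNth (α := fun _ => ℝ) 0 t (0 : Fin 3 → ℝ) : V4) 0 = t := rfl
          have e1 : (Fin.insertNth (α := fun _ => ℝ) 0 t (0 : Fin 3 → ℝ) : V4) 1 = 0 := rfl
          have e2 : (Fin.insertNth (α := fun _ => ℝ) 0 t (0 : Fin 3 → ℝ) : V4) 2 = 0 := rfl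
          have e3 : (Fin.insertNth (α := fun _ => ℝ) 0 t (0 : Fin 3 → ℝ) : V4) 3 = 0 := rfl
          apply ext4 <;> simp only [ce, qm0, qm1, qm2, qm3, e0, e1, e2, e3, PiLp.smul_apply,
            smul_eq_mul] <;> ring
        rwa [h2] at h1
      by_cases htr : t ∈ Icc (-r) r
      · have hlt : |t| < r := by
          rw [abs_lt]
          exact ⟨lt_of_le_of_ne htr.1 (Ne.symm ht.2), lt_of_le_of_ne htr.2 ht.1⟩
        have hti : t • ξ ∈ interior K := by
          have hmem : (if 0 ≤ t then r • ξ else -(r • ξ)) ∈ K := by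
            split_ifs
            · exact hrK
            · exact hneg _ hrK
          have := hKconv.combo_interior_self_mem_interior h0 hmem
            (a := 1 - |t| / r) (b := |t| / r)
            (by rw [sub_pos, div_lt_one hrp]; exact hlt) (by positivity) (by ring)
          convert this using 1
          rw [smul_zero, zero_add]
          split_ifs with h
          · rw [abs_of_nonneg h, smul_smul]; congr 1; field_simp
          · rw [abs_of_neg (not_le.1 h), smul_neg, smul_smul, ← neg_smul]; congr 1; field_simp
        rw [indicator_of_mem htr]
        refine tendsto_const_nhds.congr' ?_
        filter_upwards [hlim.eventually (isOpen_interior.mem_nhds hti)] with n hn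
        have : t ∈ slc (Kx K ξ) 0 (ε n • z) :=
          interior_subset (s := K) hn
        rw [indicator_of_mem this]
      · have htK : t • ξ ∉ K := by
          intro hmem
          apply htr
          rcases lt_trichotomy t 0 with h | h | h
          · have := hr.2 (show -t ∈ _ from ⟨by linarith, by rw [neg_smul]; exact hneg _ hmem⟩)
            exact ⟨by linarith, by linarith⟩
          · rw [h]; exact ⟨by linarith, by linarith⟩
          · have := hr.2 (show t ∈ _ from ⟨h, hmem⟩)
            exact ⟨by linarith, by linarith⟩
        rw [indicator_of_notMem htr]
        refine tendsto_const_nhds.congr' ?_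
        filter_upwards [hlim.eventually (hKcomp.isClosed.isOpen_compl.mem_nhds htK)] with n hn
        have : t ∉ slc (Kx K ξ) 0 (ε n • z) := fun h => hn h
        rw [indicator_of_notMem this]
  have e1 : ∀ n, ∫ t, (slc (Kx K ξ) 0 (ε n • z)).indicator (fun _ => (1 : ℝ)) t
      = volume.real (slc (Kx K ξ) 0 (ε n • z)) := fun n => by
    rw [integral_indicator (isClosed_slc (isCompact_Kx hKcomp hξ) 0 _).measurableSet]; simp
  have e2 : ∫ t, (Icc (-r) r).indicator (fun _ => (1 : ℝ)) t = 2 * r := by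
    rw [integral_indicator measurableSet_Icc, setIntegral_const,
      Real.volume_real_Icc_of_le (by linarith)]
    simp; ring
  simp_rw [e1, e2] at key
  exact key

lemma Pn_tendsto {K : Set E4} (hKcomp : IsCompact K) (hKconv : Convex ℝ K)
    (h0 : (0 : E4) ∈ interior K) (hKsymm : K = -K) {ξ : E4} (hξ : ‖ξ‖ = 1) {r : ℝ}
    (hr : IsGreatest {a : ℝ | 0 < a ∧ a • ξ ∈ K} r) (ε : ℕ → ℝ) (hεp : ∀ n, 0 < ε n)
    (hε : Tendsto ε atTop (𝓝 0)) :
    Tendsto (fun n => Pn K (ε n) ξ) atTop (𝓝 (2 * (∫ z, gw z) * r)) := by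
  obtain ⟨M, hM⟩ := hKcomp.isBounded.exists_norm_le
  have hM0 : 0 ≤ M := (norm_nonneg _).trans (hM 0 (interior_subset h0))
  simp_rw [fun n => Pn_eq hKcomp hξ (hεp n)]
  have : 2 * (∫ z, gw z) * r = ∫ z, 2 * r * gw z := by rw [integral_const_mul]; ring
  rw [this]
  refine tendsto_integral_of_dominated_convergence (fun z => 2 * M * gw z) (fun n => ?_)
    (integrable_gw.const_mul _) (fun n => Eventually.of_forall fun z => ?_)
    (Eventually.of_forall fun z => ?_)
  · exact (((measurable_slc hKcomp hξ).comp (measurable_const_smul (ε n))).aestronglyMeasurable).mul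
      integrable_gw.1
  · have := gw_nonneg z
    rw [norm_mul, Real.norm_of_nonneg measureReal_nonneg, Real.norm_of_nonneg this]
    exact mul_le_mul_of_nonneg_right (vol_slc_le hM0 hM hξ _) this
  · exact (slc_tendsto hKcomp hKconv h0 hKsymm hξ hr z ε hε).mul_const _


lemma integrable_prod_cpt {μ ν : Measure E4} [IsFiniteMeasure μ] [IsFiniteMeasure ν] {A B : Set E4}
    (hA : IsCompact A) (hB : IsCompact B) (hμ : μ.restrict A = μ) (hν : ν.restrict B = ν)
    {F : E4 × E4 → ℝ} (hF : Continuous F) : Integrable F (μ.prod ν) := by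
  have h := hF.continuousOn.integrableOn_compact (μ := μ.prod ν) (hA.prod hB)
  rwa [IntegrableOn, ← Measure.prod_restrict, hμ, hν] at h

lemma ta_restrict : ta.restrict S2 = ta := by
  rw [ta, Measure.restrict_restrict isClosed_S2.measurableSet, inter_self]

lemma sg_restrict : sg.restrict S3 = sg := by
  rw [sg, Measure.restrict_restrict Metric.isClosed_sphere.measurableSet, inter_self]

lemma K_restrict {K : Set E4} (hK : IsCompact K) :
    ((volume : Measure E4).restrict K).restrict K = volume.restrict K := by
  rw [Measure.restrict_restrict hK.isClosed.measurableSet, inter_self]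

lemma integrable_sg {f : E4 → ℝ} (hf : Continuous f) : Integrable f sg := by
  have h := hf.continuousOn.integrableOn_compact (μ := sg) (isCompact_sphere (0 : E4) 1)
  rwa [IntegrableOn, sg_restrict] at h

lemma continuous_radon {f : E4 → ℝ} (hf : Continuous f) :
    Continuous fun ξ => ∫ u, f (qm ξ u) ∂ta := by
  have := continuous_parametric_integral_of_continuous (μ := ta) (f := fun ξ u => f (qm ξ u))
    (by unfold Function.uncurry; fun_prop) isCompact_S2
  rwa [ta_restrict] at this

lemma qc_pure {u : E4} (hu : u 0 = 0) : qc u = -u := by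
  apply ext4 <;> simp [qc0, qc1, qc2, qc3, hu]

lemma qm_neg_right (x u : E4) : qm x (-u) = - qm x u := by
  rw [← neg_one_smul ℝ u, qm_smul_right, neg_one_smul]

lemma radon_adj {f g : E4 → ℝ} (hf : Continuous f) (hg : Continuous g) (he : ∀ x, g (-x) = g x) :
    ∫ ξ, (∫ u, f (qm ξ u) ∂ta) * g ξ ∂sg = ∫ ξ, f ξ * (∫ u, g (qm ξ u) ∂ta) ∂sg := by
  simp_rw [← integral_mul_const, ← integral_const_mul]
  rw [integral_integral_swap (integrable_prod_cpt (isCompact_sphere (0 : E4) 1) isCompact_S2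
      sg_restrict ta_restrict (by unfold Function.uncurry; fun_prop)),
    integral_integral_swap (integrable_prod_cpt (isCompact_sphere (0 : E4) 1) isCompact_S2
      sg_restrict ta_restrict (by unfold Function.uncurry; fun_prop))]
  refine integral_congr_ae ?_
  filter_upwards [ae_ta] with u hu
  rw [← sg_right_inv (fun ξ => f ξ * g (qm ξ u)) hu.1]
  congr 1
  funext ξ
  have h := qm_qm_qc hu.1 ξ
  rw [qc_pure hu.2, qm_neg_right] at h
  have h2 := he (qm (qm ξ u) u)
  rw [h] at h2
  rw [h2]

noncomputable def gN (K : Set E4) (ε : ℝ) (ξ : E4) : ℝ := (ε ^ 3)⁻¹ * ∫ y in K, ph (⟪y, ξ⟫ / ε)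

lemma continuous_gN {K : Set E4} (hK : IsCompact K) (ε : ℝ) : Continuous (gN K ε) := by
  have := continuous_parametric_integral_of_continuous (μ := (volume : Measure E4))
    (f := fun ξ y => ph (⟪y, ξ⟫ / ε)) (by unfold Function.uncurry; fun_prop) hK
  unfold gN
  exact continuous_const.mul this

lemma continuous_Pn {K : Set E4} (hK : IsCompact K) (ε : ℝ) : Continuous (Pn K ε) := by
  have := continuous_parametric_integral_of_continuous (μ := (volume : Measure E4))
    (f := fun ξ y => Real.exp (-((‖y‖ ^ 2 - ⟪y, ξ⟫ ^ 2) / ε ^ 2)))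
    (by unfold Function.uncurry; fun_prop) hK
  unfold Pn
  exact continuous_const.mul this

lemma even_gN (K : Set E4) (ε : ℝ) (x : E4) : gN K ε (-x) = gN K ε x := by
  unfold gN
  simp only [inner_neg_right, neg_div, ph, neg_sq]

lemma radon_gN {K : Set E4} (hK : IsCompact K) {ε : ℝ} (hε : 0 < ε) {ξ : E4} (hξ : ‖ξ‖ = 1) :
    ∫ u, gN K ε (qm ξ u) ∂ta = ta.real univ * Pn K ε ξ := by
  have : IsFiniteMeasure ((volume : Measure E4).restrict K) :=
    ⟨by rw [Measure.restrict_apply_univ]; exact hK.measure_lt_top⟩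
  unfold gN Pn
  rw [integral_const_mul, integral_integral_swap (integrable_prod_cpt isCompact_S2 hK ta_restrict
    (K_restrict hK) (by unfold Function.uncurry; fun_prop))]
  rw [mul_left_comm]
  congr 1
  rw [← integral_const_mul]
  congr 1
  funext y
  have h := archimedes (ε⁻¹ • qm (qc ξ) y)
  have h0 : qm (qc ξ) y 0 = ⟪y, ξ⟫ := by
    rw [inner4]; simp only [qm0, qc0, qc1, qc2, qc3]; ring
  have hn : ‖qm (qc ξ) y‖ = ‖y‖ := by rw [norm_qm, norm_qc, hξ, one_mul]
  rw [norm_smul, PiLp.smul_apply, hn, h0] at h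
  simp only [inner_smul_left, ← inner_qm] at h
  convert h using 3
  · congr 1
    simp [div_eq_inv_mul]
  · congr 1
    rw [Real.norm_of_nonneg (by positivity)]
    simp only [smul_eq_mul]
    field_simp

lemma zero_mem_int {K : Set E4} (hKconv : Convex ℝ K) (hKint : (interior K).Nonempty)
    (hKsymm : K = -K) : (0 : E4) ∈ interior K := by
  obtain ⟨x, hx⟩ := hKint
  have hx2 : -x ∈ K := by
    have h1 : x ∈ K := interior_subset hx
    rw [hKsymm] at h1
    exact h1
  have := hKconv.combo_interior_self_mem_interior hx hx2 (a := 1 / 2) (b := 1 / 2)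
    (by norm_num) (by norm_num) (by norm_num)
  simpa using this

lemma key_identity {K : Set E4} (hK : IsCompact K) {ε : ℝ} (hε : 0 < ε) {f : E4 → ℝ}
    (hf : Continuous f) :
    ∫ ξ, (∫ u, f (qm ξ u) ∂ta) * gN K ε ξ ∂sg = ta.real univ * ∫ ξ, f ξ * Pn K ε ξ ∂sg := by
  rw [radon_adj hf (continuous_gN hK ε) (even_gN K ε), ← integral_const_mul]
  refine integral_congr_ae ?_
  filter_upwards [ae_sg] with ξ hξ
  rw [radon_gN hK hε hξ]; ring

lemma lim_f {K : Set E4} (hKcomp : IsCompact K) (hKconv : Convex ℝ K)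
    (hKint : (interior K).Nonempty) (hKsymm : K = -K) (ρ : E4 → ℝ)
    (hρ : ∀ x : E4, ‖x‖ = 1 → IsGreatest {a : ℝ | 0 < a ∧ a • x ∈ K} (ρ x))
    (ε : ℕ → ℝ) (hεp : ∀ n, 0 < ε n) (hε : Tendsto ε atTop (𝓝 0)) {f : E4 → ℝ}
    (hf : Continuous f) :
    Tendsto (fun n => ∫ ξ, f ξ * Pn K (ε n) ξ ∂sg) atTop
      (𝓝 (2 * (∫ z, gw z) * ∫ ξ, ρ ξ * f ξ ∂sg)) := by
  obtain ⟨M, hM⟩ := hKcomp.isBounded.exists_norm_le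
  have h0 := zero_mem_int hKconv hKint hKsymm
  have hM0 : 0 ≤ M := (norm_nonneg _).trans (hM 0 (interior_subset h0))
  rw [← integral_const_mul]
  refine tendsto_integral_of_dominated_convergence (fun ξ => ‖f ξ‖ * (2 * M * ∫ z, gw z))
    (fun n => ?_) ?_ (fun n => ?_) ?_
  · exact (hf.mul (continuous_Pn hKcomp _)).aestronglyMeasurable
  · exact integrable_sg (by fun_prop)
  · filter_upwards [ae_sg] with ξ hξ
    rw [norm_mul]
    exact mul_le_mul_of_nonneg_left (Pn_bound hKcomp hM0 hM hξ (hεp n)) (norm_nonneg _)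
  · filter_upwards [ae_sg] with ξ hξ
    have := (Pn_tendsto hKcomp hKconv h0 hKsymm hξ (hρ ξ hξ) ε hεp hε).const_mul (f ξ)
    convert this using 2
    ring

noncomputable def sgS : Measure (Metric.sphere (0 : E4) 1) :=
  (μH[3] : Measure E4).comap Subtype.val

lemma integral_sgS (f : E4 → ℝ) : ∫ x : Metric.sphere (0 : E4) 1, f x ∂sgS = ∫ x, f x ∂sg :=
  integral_subtype_comap Metric.isClosed_sphere.measurableSet f

noncomputable def dn (K : Set E4) (ε : ℝ) : Measure (Metric.sphere (0 : E4) 1) :=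
  sgS.withDensity fun ξ => ((gN K ε ξ).toNNReal : ℝ≥0∞)

lemma integral_dn {K : Set E4} (hKcomp : IsCompact K) (hKconv : Convex ℝ K) (hKsymm : K = -K)
    {ε : ℝ} (hε : 0 < ε) (f : E4 → ℝ) :
    ∫ x : Metric.sphere (0 : E4) 1, f x ∂(dn K ε) = ∫ x, f x * gN K ε x ∂sg := by
  have hc := continuous_gN hKcomp ε
  rw [dn, integral_withDensity_eq_integral_smul (by fun_prop)]
  rw [← integral_sgS]
  congr 1
  funext ξ
  have hξ : ‖(ξ : E4)‖ = 1 := by simpa using ξ.2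
  have : 0 ≤ gN K ε ξ := mul_nonneg (by positivity) (g_nonneg hKcomp hKconv hKsymm hξ hε)
  rw [NNReal.smul_def, Real.coe_toNNReal _ this, smul_eq_mul, mul_comm]

instance : IsFiniteMeasure sgS := by
  refine ⟨?_⟩
  rw [sgS, comap_subtype_coe_apply Metric.isClosed_sphere.measurableSet]
  rw [image_univ, Subtype.range_coe]
  exact h3_lt_top

lemma finite_dn {K : Set E4} (hK : IsCompact K) (ε : ℝ) : IsFiniteMeasure (dn K ε) := by
  have hc := continuous_gN hK ε
  obtain ⟨C, hC⟩ := (isCompact_sphere (0 : E4) 1).exists_bound_of_continuousOn hc.continuousOn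
  refine isFiniteMeasure_withDensity (ne_of_lt ?_)
  calc ∫⁻ ξ, ((gN K ε (ξ : E4)).toNNReal : ℝ≥0∞) ∂sgS ≤ ∫⁻ ξ, (C.toNNReal : ℝ≥0∞) ∂sgS := by
        refine lintegral_mono fun ξ => ?_
        exact ENNReal.coe_le_coe.2 <| Real.toNNReal_le_toNNReal ((le_abs_self _).trans (hC ξ ξ.2))
    _ < ⊤ := by
        rw [lintegral_const]
        exact ENNReal.mul_lt_top ENNReal.coe_lt_top (measure_lt_top _ _)

theorem main_result (K : Set E4)
    (hKcomp : IsCompact K) (hKconv : Convex ℝ K)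
    (hKint : (interior K).Nonempty) (hKsymm : K = -K)
    (ρ : E4 → ℝ)
    (hρ : ∀ x : E4, ‖x‖ = 1 → IsGreatest {a : ℝ | 0 < a ∧ a • x ∈ K} (ρ x)) :
    ∃ μ : Measure (Metric.sphere (0 : E4) 1), IsFiniteMeasure μ ∧
      ∀ f : E4 → ℝ, Continuous f →
        ∫ x, ρ x * f x ∂sg = ∫ ξ : Metric.sphere (0 : E4) 1, (∫ u, f (qm ξ u) ∂ta) ∂μ := by
  let ε : ℕ → ℝ := fun n => 1 / ((n : ℝ) + 1)
  have hεp : ∀ n, 0 < ε n := fun n => Nat.one_div_pos_of_nat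
  have hε : Tendsto ε atTop (𝓝 0) := tendsto_one_div_add_atTop_nhds_zero_nat
  have hT := ta_pos
  have hG := gw_pos
  obtain ⟨M, hM⟩ := hKcomp.isBounded.exists_norm_le
  have h0 := zero_mem_int hKconv hKint hKsymm
  have hM0 : 0 ≤ M := (norm_nonneg _).trans (hM 0 (interior_subset h0))
  let m : ℕ → FiniteMeasure (Metric.sphere (0 : E4) 1) := fun n => ⟨dn K (ε n), finite_dn hKcomp _⟩
  have hmass : ∃ C : ℝ≥0, ∀ n, (m n).mass ≤ C := by
    refine ⟨(∫ x, (2 * M * ∫ z, gw z) ∂sg).toNNReal, fun n => ?_⟩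
    rw [← NNReal.coe_le_coe]
    refine le_trans ?_ (Real.le_coe_toNNReal _)
    have e1 : ((m n).mass : ℝ) = ∫ x : Metric.sphere (0 : E4) 1, (fun _ : E4 => (1 : ℝ)) x ∂(dn K (ε n)) := by
      rw [integral_const, smul_eq_mul, mul_one]; rfl
    rw [e1, integral_dn hKcomp hKconv hKsymm (hεp n) (fun _ => 1)]
    have e2 := key_identity hKcomp (hεp n) (f := fun _ => (1 : ℝ)) continuous_const
    simp only [integral_const, smul_eq_mul, mul_one, one_mul] at e2 ⊢
    rw [integral_const_mul] at e2
    rw [mul_left_cancel₀ hT.ne' e2]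
    have h3 : ∫ ξ, Pn K (ε n) ξ ∂sg ≤ ∫ ξ, (2 * M * ∫ z, gw z) ∂sg := by
      refine integral_mono_ae (integrable_sg (continuous_Pn hKcomp _)) (integrable_const _) ?_
      filter_upwards [ae_sg] with ξ hξ
      exact (le_abs_self _).trans (Pn_bound hKcomp hM0 hM hξ (hεp n))
    simpa using h3
  obtain ⟨C, hC⟩ := hmass
  have hcpt := isCompact_setOfPred_finiteMeasure_le_of_compactSpace (Metric.sphere (0 : E4) 1) C
  obtain ⟨ν, -, hν⟩ := isCompact_iff_ultrafilter_le_nhds.1 hcpt ((hyperfilter ℕ).map m) (by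
    rw [le_principal_iff]
    exact Eventually.of_forall (f := (hyperfilter ℕ : Filter ℕ)) hC)
  have hlim : Tendsto m (hyperfilter ℕ) (𝓝 ν) := hν
  rw [FiniteMeasure.tendsto_iff_forall_integral_tendsto] at hlim
  refine ⟨(ta.real univ * (2 * ∫ z, gw z))⁻¹.toNNReal • (ν : Measure (Metric.sphere (0 : E4) 1)),
    inferInstance, fun f hf => ?_⟩
  have hR := continuous_radon hf
  have h1 := hlim (BoundedContinuousFunction.mkOfCompact
    ⟨fun ξ => ∫ u, f (qm (ξ : E4) u) ∂ta, hR.comp continuous_subtype_val⟩)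
  have h2 : ∀ n, ∫ ξ : Metric.sphere (0 : E4) 1, (∫ u, f (qm (ξ : E4) u) ∂ta) ∂(m n : Measure _)
      = ta.real univ * ∫ ξ, f ξ * Pn K (ε n) ξ ∂sg := fun n => by
    rw [← key_identity hKcomp (hεp n) hf]
    exact integral_dn hKcomp hKconv hKsymm (hεp n) (fun ξ => ∫ u, f (qm ξ u) ∂ta)
  simp only [BoundedContinuousFunction.mkOfCompact_apply, ContinuousMap.coe_mk, h2] at h1
  have h3 := ((lim_f hKcomp hKconv hKint hKsymm ρ hρ ε hεp hε hf).const_mul (ta.real univ)).mono_left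
    (Nat.hyperfilter_le_atTop)
  have h4 := tendsto_nhds_unique h1 h3
  rw [integral_smul_nnreal_measure, h4, NNReal.smul_def, Real.coe_toNNReal _ (by positivity),
    smul_eq_mul]
  field_simp


end


open MeasureTheory Set
open scoped RealInnerProductSpace ENNReal

/-- Theorem 3: every origin-symmetric convex body `K` in `ℝ⁴` is an intersection body:
there is a finite non-negative Borel measure `μ` on the sphere `S³` such that
`∫_{S³} ρ_K(x) f(x) dx = ∫_{S³} (∫_{S³ ∩ ξ^⊥} f(x) dx) dμ(ξ)` for every continuous `f`,
the inner integrals being with respect to Hausdorff measure of the appropriate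
dimension. -/
theorem every_symmetric_convex_body_in_R4_is_intersection_body
    (K : Set (EuclideanSpace ℝ (Fin 4)))
    (hKcomp : IsCompact K) (hKconv : Convex ℝ K)
    (hKint : (interior K).Nonempty) (hKsymm : K = -K)
    (ρ : EuclideanSpace ℝ (Fin 4) → ℝ)
    (hρ : ∀ x : EuclideanSpace ℝ (Fin 4), ‖x‖ = 1 →
      IsGreatest {a : ℝ | 0 < a ∧ a • x ∈ K} (ρ x)) :
    ∃ μ : Measure (Metric.sphere (0 : EuclideanSpace ℝ (Fin 4)) 1),
      IsFiniteMeasure μ ∧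
      ∀ f : EuclideanSpace ℝ (Fin 4) → ℝ, Continuous f →
        ∫ x in Metric.sphere (0 : EuclideanSpace ℝ (Fin 4)) 1, ρ x * f x ∂μH[3]
          = ∫ ξ : Metric.sphere (0 : EuclideanSpace ℝ (Fin 4)) 1,
              (∫ x in Metric.sphere (0 : EuclideanSpace ℝ (Fin 4)) 1 ∩
                  {x : EuclideanSpace ℝ (Fin 4) | ⟪x, (ξ : EuclideanSpace ℝ (Fin 4))⟫ = 0},
                f x ∂μH[2]) ∂μ := by
  obtain ⟨μ, hμ, h⟩ := main_result K hKcomp hKconv hKint hKsymm ρ hρ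
  refine ⟨μ, hμ, fun f hf => (h f hf).trans ?_⟩
  congr 1
  funext ξ
  exact (radon_eq f (by simpa using ξ.2)).symm
end
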